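/- arXiv:2512.13535 — 2 statements merged into one kernel-verified Lean document; each statement's English description precedes it below -/
import Mathlib

section
/- (Propagation of the total variation.) Let d ≥ 1, ε ≥ 0, T > 0. Let f : ℝ → ℝ be twice continuously differentiable, and let K : ℝ^d → ℝ^d be continuously differentiable and bounded, with ∫_{ℝ^d}‖DK(x)‖dx < ∞ (DK the Jacobian matrix) and ∫_{ℝ^d}|div K(x)|dx < ∞. Let u : [0,T] × ℝ^d → ℝ be continuous and bounded, continuously differentiable in t and three times continuously differentiable in x, with u(t,·) integrable for each t, with all spatial derivatives of u up to order three continuous and dominated by a fixed integrable function of x uniformly in t, and satisfying pointwise on (0,T)×ℝ^d the equation ∂_t u + div_x(f(u)·(K∗u)) = ε·Δ_x u. For s ∈ [0,T] set m(s) := sup_x |u(s,x)|. Then for every t ∈ [0,T]: ∫_{ℝ^d} ‖∇_x u(t,x)‖ dx ≤ exp( ∫_0^t [ (sup_{|ξ| ≤ m(s)}|f(ξ)|)·∫|div K| + (sup_{|ξ| ≤ m(s)}|f′(ξ)|)·(∫‖DK‖)·m(s) ] ds )·∫_{ℝ^d} ‖∇_x u(0,x)‖ dx. -/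
open MeasureTheory Real
open scoped RealInnerProductSpace

noncomputable section

/-- `d`-dimensional Euclidean space. -/
abbrev Euc (d : ℕ) := EuclideanSpace ℝ (Fin d)

/-- Divergence of a vector field on `ℝ^d`. -/
def diverg {d : ℕ} (V : Euc d → Euc d) (x : Euc d) : ℝ :=
  ∑ i, ⟪fderiv ℝ V x (EuclideanSpace.single i 1), EuclideanSpace.single i (1:ℝ)⟫

/-- Laplacian of a scalar function on `ℝ^d`. -/
def lap {d : ℕ} (u : Euc d → ℝ) (x : Euc d) : ℝ :=
  ∑ i, fderiv ℝ (fun y => fderiv ℝ u y (EuclideanSpace.single i 1)) x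
    (EuclideanSpace.single i 1)

section SmoothNorm

variable {V : Type*} [NormedAddCommGroup V]

/-- The regularised norm `√(‖p‖² + δ²) - δ`. -/
def smoothNorm (δ : ℝ) (p : V) : ℝ := √(‖p‖ ^ 2 + δ ^ 2) - δ

variable {δ : ℝ}

lemma smoothNorm_radicand_pos (hδ : 0 < δ) (p : V) : 0 < ‖p‖ ^ 2 + δ ^ 2 := by positivity

lemma smoothNorm_nonneg (p : V) : 0 ≤ smoothNorm δ p := by
  have : δ ≤ √(‖p‖ ^ 2 + δ ^ 2) := Real.le_sqrt_of_sq_le (by nlinarith [sq_nonneg ‖p‖])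
  unfold smoothNorm; linarith

lemma smoothNorm_le_norm (hδ : 0 < δ) (p : V) : smoothNorm δ p ≤ ‖p‖ := by
  have : √(‖p‖ ^ 2 + δ ^ 2) ≤ ‖p‖ + δ :=
    Real.sqrt_le_iff.2 ⟨by positivity, by nlinarith [norm_nonneg p]⟩
  unfold smoothNorm; linarith

lemma norm_sub_le_smoothNorm (p : V) : ‖p‖ - δ ≤ smoothNorm δ p := by
  have : ‖p‖ ≤ √(‖p‖ ^ 2 + δ ^ 2) := Real.le_sqrt_of_sq_le (by nlinarith [sq_nonneg δ])
  unfold smoothNorm; linarith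

variable [InnerProductSpace ℝ V]

/-- The gradient of the regularised norm. -/
def smoothDir (δ : ℝ) (p : V) : V := (√(‖p‖ ^ 2 + δ ^ 2))⁻¹ • p

lemma norm_smoothDir_le (hδ : 0 < δ) (p : V) : ‖smoothDir δ p‖ ≤ 1 := by
  have h0 : 0 < √(‖p‖ ^ 2 + δ ^ 2) := Real.sqrt_pos.2 (smoothNorm_radicand_pos hδ p)
  have : ‖p‖ ≤ √(‖p‖ ^ 2 + δ ^ 2) := Real.le_sqrt_of_sq_le (by nlinarith [sq_nonneg δ])
  rw [smoothDir, norm_smul, norm_inv, Real.norm_of_nonneg h0.le, inv_mul_le_iff₀ h0]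
  linarith

lemma contDiff_smoothNorm (hδ : 0 < δ) {n : WithTop ℕ∞} :
    ContDiff ℝ n (smoothNorm δ : V → ℝ) :=
  (((contDiff_norm_sq ℝ).add contDiff_const).sqrt
    fun p => (smoothNorm_radicand_pos hδ p).ne').sub contDiff_const

lemma contDiff_smoothDir (hδ : 0 < δ) {n : WithTop ℕ∞} :
    ContDiff ℝ n (smoothDir δ : V → V) :=
  ((((contDiff_norm_sq ℝ).add contDiff_const).sqrt
    fun p => (smoothNorm_radicand_pos hδ p).ne').inv
    fun p => (Real.sqrt_pos.2 (smoothNorm_radicand_pos hδ p)).ne').smul contDiff_id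

lemma hasFDerivAt_sqrt_norm_sq_add (hδ : 0 < δ) (p : V) :
    HasFDerivAt (fun q : V => √(‖q‖ ^ 2 + δ ^ 2)) (innerSL ℝ (smoothDir δ p)) p := by
  have h1 : HasFDerivAt (fun q : V => ‖q‖ ^ 2 + δ ^ 2) (2 • innerSL ℝ p) p :=
    ((hasStrictFDerivAt_norm_sq p).hasFDerivAt).add_const _
  refine (h1.sqrt (smoothNorm_radicand_pos hδ p).ne').congr_fderiv ?_
  ext v
  simp [smoothDir]
  ring

lemma hasFDerivAt_smoothNorm (hδ : 0 < δ) (p : V) :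
    HasFDerivAt (smoothNorm δ : V → ℝ) (innerSL ℝ (smoothDir δ p)) p :=
  (hasFDerivAt_sqrt_norm_sq_add hδ p).sub_const _

lemma inner_fderiv_smoothDir_nonneg (hδ : 0 < δ) (p h : V) :
    0 ≤ ⟪fderiv ℝ (smoothDir δ) p h, h⟫ := by
  have hpos := smoothNorm_radicand_pos hδ p
  have hs : 0 < √(‖p‖ ^ 2 + δ ^ 2) := Real.sqrt_pos.2 hpos
  have h1 : HasFDerivAt (fun q : V => (√(‖q‖ ^ 2 + δ ^ 2))⁻¹)
      (-((√(‖p‖ ^ 2 + δ ^ 2)) ^ 2)⁻¹ • innerSL ℝ (smoothDir δ p)) p :=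
    (hasDerivAt_inv hs.ne').comp_hasFDerivAt p (hasFDerivAt_sqrt_norm_sq_add hδ p)
  have h2 : HasFDerivAt (smoothDir δ : V → V) _ p := h1.smul (hasFDerivAt_id p)
  rw [h2.fderiv]
  set s := √(‖p‖ ^ 2 + δ ^ 2) with hs_def
  have hs2 : s ^ 2 = ‖p‖ ^ 2 + δ ^ 2 := Real.sq_sqrt hpos.le
  have hcs : ⟪p, h⟫ ^ 2 ≤ ‖p‖ ^ 2 * ‖h‖ ^ 2 := by
    rw [← mul_pow]; exact sq_le_sq' (by
      have := abs_real_inner_le_norm p h; rw [abs_le] at this; linarith [this.1])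
      (real_inner_le_norm p h)
  have key : ⟪(s⁻¹ • ContinuousLinearMap.id ℝ V +
      (-(s ^ 2)⁻¹ • innerSL ℝ (smoothDir δ p)).smulRight (id p)) h, h⟫
      = s⁻¹ ^ 3 * (s ^ 2 * ‖h‖ ^ 2 - ⟪p, h⟫ ^ 2) := by
    simp only [add_apply, smul_apply,
      ContinuousLinearMap.id_apply, ContinuousLinearMap.smulRight_apply, innerSL_apply_apply,
      smoothDir, ← hs_def, inner_add_left, inner_smul_left, real_inner_self_eq_norm_sq, id,
      smul_eq_mul, conj_trivial]
    field_simp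
    ring
  refine le_of_le_of_eq ?_ key.symm
  have : 0 ≤ s ^ 2 * ‖h‖ ^ 2 - ⟪p, h⟫ ^ 2 := by
    rw [hs2]; nlinarith [mul_nonneg (sq_nonneg δ) (sq_nonneg ‖h‖)]
  positivity

/-- Convexity of the regularised norm. -/
lemma smoothNorm_add_inner_le (hδ : 0 < δ) (p q : V) :
    smoothNorm δ q + ⟪smoothDir δ q, p - q⟫ ≤ smoothNorm δ p := by
  have hp := smoothNorm_radicand_pos hδ p
  have hq := smoothNorm_radicand_pos hδ q
  have hsq : 0 < √(‖q‖ ^ 2 + δ ^ 2) := Real.sqrt_pos.2 hq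
  have hsp : 0 < √(‖p‖ ^ 2 + δ ^ 2) := Real.sqrt_pos.2 hp
  have e1 := Real.sq_sqrt hp.le
  have e2 := Real.sq_sqrt hq.le
  simp only [smoothNorm, smoothDir, inner_smul_left, inner_sub_right, real_inner_self_eq_norm_sq,
    conj_trivial]
  set a := √(‖p‖ ^ 2 + δ ^ 2)
  set b := √(‖q‖ ^ 2 + δ ^ 2)
  have hin : ⟪q, p⟫ ≤ ‖q‖ * ‖p‖ := real_inner_le_norm q p
  have hab : ‖q‖ * ‖p‖ + δ ^ 2 ≤ b * a := by
    refine abs_le_of_sq_le_sq' ?_ (by positivity) |>.2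
    rw [mul_pow, e1, e2]
    nlinarith [sq_nonneg (δ * ‖q‖ - δ * ‖p‖)]
  have : b⁻¹ * (⟪q, p⟫ - ‖q‖ ^ 2) ≤ a - b := by
    rw [inv_mul_le_iff₀ hsq]
    nlinarith
  linarith

lemma smoothNorm_le_inner (hδ : 0 < δ) (p : V) : smoothNorm δ p ≤ ⟪smoothDir δ p, p⟫ := by
  have := smoothNorm_add_inner_le hδ 0 p
  have h0 : smoothNorm δ (0 : V) = 0 := by simp [smoothNorm, Real.sqrt_sq hδ.le]
  simp [h0] at this
  linarith

lemma inner_le_smoothNorm_add (hδ : 0 < δ) (p : V) :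
    ⟪smoothDir δ p, p⟫ ≤ smoothNorm δ p + δ := by
  have h1 : ⟪smoothDir δ p, p⟫ ≤ ‖p‖ :=
    (real_inner_le_norm _ _).trans
      (by nlinarith [norm_smoothDir_le hδ p, norm_nonneg p])
  linarith [norm_sub_le_smoothNorm (δ := δ) p]

end SmoothNorm

section Divergence

variable {d : ℕ}

lemma sum_inner_single_smul (w : Euc d) :
    ∑ i, ⟪w, EuclideanSpace.single i (1 : ℝ)⟫ • EuclideanSpace.single i (1 : ℝ) = w := by
  conv_rhs => rw [← (EuclideanSpace.basisFun (Fin d) ℝ).sum_repr' w]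
  simp [EuclideanSpace.basisFun_apply, real_inner_comm]

lemma diverg_smul {φ : Euc d → ℝ} {W : Euc d → Euc d} {x : Euc d}
    (hφ : DifferentiableAt ℝ φ x) (hW : DifferentiableAt ℝ W x) :
    diverg (fun z => φ z • W z) x = φ x * diverg W x + fderiv ℝ φ x (W x) := by
  have h := (hφ.hasFDerivAt.smul hW.hasFDerivAt).fderiv
  simp only [diverg]
  rw [show (fun z => φ z • W z) = φ • W from rfl, h]
  simp only [add_apply, smul_apply,
    ContinuousLinearMap.smulRight_apply, inner_add_left, inner_smul_left, conj_trivial,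
    Finset.sum_add_distrib, ← Finset.mul_sum]
  congr 1
  conv_rhs => rw [← sum_inner_single_smul (W x)]
  simp [map_sum, mul_comm]

lemma continuous_diverg {W : Euc d → Euc d} (hW : ContDiff ℝ 1 W) : Continuous (diverg W) := by
  have := hW.continuous_fderiv one_ne_zero
  unfold diverg
  fun_prop

lemma diverg_eq_zero_of_notMem_tsupport {W : Euc d → Euc d} {x : Euc d} (hx : x ∉ tsupport W) :
    diverg W x = 0 := by
  have : fderiv ℝ W x = 0 :=
    image_eq_zero_of_notMem_tsupport fun h => hx (tsupport_fderiv_subset ℝ h)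
  simp [diverg, this]

lemma HasCompactSupport.diverg {W : Euc d → Euc d} (hc : HasCompactSupport W) :
    HasCompactSupport (diverg W) :=
  HasCompactSupport.intro hc fun _ hx => diverg_eq_zero_of_notMem_tsupport hx

/-- Integration by parts for the divergence of a compactly supported field. -/
lemma integral_diverg_mul {W : Euc d → Euc d} {q : Euc d → ℝ} (hW : ContDiff ℝ 1 W)
    (hc : HasCompactSupport W) (hq : ContDiff ℝ 1 q) :
    ∫ x, diverg W x * q x = -∫ x, fderiv ℝ q x (W x) := by
  have hW' := hW.continuous_fderiv one_ne_zero
  have hq' := hq.continuous_fderiv one_ne_zero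
  have cW := hW.continuous
  have cq := hq.continuous
  set e : Fin d → Euc d := fun i => EuclideanSpace.single i (1 : ℝ) with he
  have hWi : ∀ i, ContDiff ℝ 1 fun x => ⟪W x, e i⟫ := fun i => hW.inner ℝ contDiff_const
  have hfd : ∀ i x, fderiv ℝ (fun x => ⟪W x, e i⟫) x (e i) = ⟪fderiv ℝ W x (e i), e i⟫ := by
    intro i x
    have := ((hW.differentiable one_ne_zero x).hasFDerivAt.inner ℝ
      (hasFDerivAt_const (e i) x)).fderiv
    rw [this]; simp
  have hci : ∀ i, HasCompactSupport fun x => ⟪W x, e i⟫ := fun i =>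
    hc.comp_left (g := fun w => ⟪w, e i⟫) (inner_zero_left _)
  have hcd : ∀ i, HasCompactSupport fun x => ⟪fderiv ℝ W x (e i), e i⟫ := fun i =>
    (hc.fderiv ℝ).comp_left (g := fun (L : Euc d →L[ℝ] Euc d) => ⟪L (e i), e i⟫) (by simp)
  have i1 : ∀ i, Integrable fun x => ⟪fderiv ℝ W x (e i), e i⟫ * q x := fun i =>
    Continuous.integrable_of_hasCompactSupport (by fun_prop) ((hcd i).mul_right)
  have i2 : ∀ i, Integrable fun x => ⟪W x, e i⟫ * fderiv ℝ q x (e i) := fun i =>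
    Continuous.integrable_of_hasCompactSupport (by fun_prop) ((hci i).mul_right)
  have i3 : ∀ i, Integrable fun x => ⟪W x, e i⟫ * q x := fun i =>
    Continuous.integrable_of_hasCompactSupport (by fun_prop) ((hci i).mul_right)
  calc ∫ x, diverg W x * q x
      = ∑ i, ∫ x, ⟪fderiv ℝ W x (e i), e i⟫ * q x := by
        rw [← integral_finsetSum _ fun i _ => i1 i]
        simp [diverg, Finset.sum_mul, he]
    _ = ∑ i, -∫ x, ⟪W x, e i⟫ * fderiv ℝ q x (e i) := by
        refine Finset.sum_congr rfl fun i _ => ?_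
        have := integral_mul_fderiv_eq_neg_fderiv_mul_of_integrable (μ := volume)
          (f := fun x => ⟪W x, e i⟫) (g := q) (v := e i)
          (by simpa only [hfd] using i1 i) (i2 i) (i3 i)
          (fun x _ => (hWi i).differentiable one_ne_zero x)
          (fun x _ => hq.differentiable one_ne_zero x)
        rw [this]
        simp only [hfd, neg_neg]
    _ = -∫ x, fderiv ℝ q x (W x) := by
        rw [Finset.sum_neg_distrib, ← integral_finsetSum _ fun i _ => i2 i]
        congr 2 with x
        conv_rhs => rw [← sum_inner_single_smul (W x)]
        simp [map_sum, he]

end Divergence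

section Convolution

variable {d : ℕ} {G : Type*} [NormedAddCommGroup G] [NormedSpace ℝ G]

lemma integrable_smul_fderiv_sub {k : Euc d → G} {w : Euc d → ℝ} {M : ℝ} (hk : ContDiff ℝ 1 k)
    (hw : Continuous w) (hwM : ∀ y, |w y| ≤ M) (hDk : Integrable fun x => ‖fderiv ℝ k x‖)
    (x : Euc d) : Integrable fun y => w y • fderiv ℝ k (x - y) := by
  have ck := hk.continuous_fderiv one_ne_zero
  refine ((hDk.comp_sub_left x).const_mul M).mono' (by fun_prop) (.of_forall fun y => ?_)
  rw [norm_smul]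
  exact mul_le_mul_of_nonneg_right (hwM y) (norm_nonneg _)

lemma continuous_integral_smul_fderiv_sub {k : Euc d → G} {w : Euc d → ℝ} {M : ℝ}
    (hk : ContDiff ℝ 1 k) (hw : Continuous w) (hwM : ∀ y, |w y| ≤ M)
    (hDk : Integrable fun x => ‖fderiv ℝ k x‖) :
    Continuous fun x => ∫ y, w y • fderiv ℝ k (x - y) := by
  have ck := hk.continuous_fderiv one_ne_zero
  have h : (fun x => ∫ y, w y • fderiv ℝ k (x - y)) =
      fun x => ∫ z, w (x - z) • fderiv ℝ k z := by
    ext1 x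
    rw [← integral_sub_left_eq_self (fun z => w (x - z) • fderiv ℝ k z) volume x]
    simp
  rw [h]
  refine continuous_of_dominated (bound := fun z => M * ‖fderiv ℝ k z‖)
    (fun x => by fun_prop) (fun x => .of_forall fun z => ?_) (hDk.const_mul M)
    (.of_forall fun z => by fun_prop)
  rw [norm_smul]
  exact mul_le_mul_of_nonneg_right (hwM _) (norm_nonneg _)

lemma norm_integral_smul_fderiv_sub_le {k : Euc d → G} {w : Euc d → ℝ} {M : ℝ}
    (hwM : ∀ y, |w y| ≤ M) (hDk : Integrable fun x => ‖fderiv ℝ k x‖) (x : Euc d) :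
    ‖∫ y, w y • fderiv ℝ k (x - y)‖ ≤ M * ∫ y, ‖fderiv ℝ k y‖ := by
  calc _ ≤ ∫ y, M * ‖fderiv ℝ k (x - y)‖ := by
        refine norm_integral_le_of_norm_le ((hDk.comp_sub_left x).const_mul M)
          (.of_forall fun y => ?_)
        rw [norm_smul]
        exact mul_le_mul_of_nonneg_right (hwM _) (norm_nonneg _)
    _ = _ := by
        rw [integral_const_mul, integral_sub_left_eq_self (fun y => ‖fderiv ℝ k y‖)]

lemma integrable_prod_smul_fderiv_sub {k : Euc d → G} {w : Euc d → ℝ} {M : ℝ}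
    (hk : ContDiff ℝ 1 k) (hw : Continuous w) (hwM : ∀ y, |w y| ≤ M)
    (hDk : Integrable fun x => ‖fderiv ℝ k x‖) (x h : Euc d) :
    Integrable (Function.uncurry fun (s : ℝ) (y : Euc d) =>
      (w y • fderiv ℝ k (x + s • h - y)) h)
      ((volume.restrict (Set.uIoc 0 1)).prod volume) := by
  have ck := hk.continuous_fderiv one_ne_zero
  have c1 : Continuous fun p : ℝ × Euc d => fderiv ℝ k (x + p.1 • h - p.2) :=
    ck.comp (by fun_prop)
  have h1 : Integrable (fun p : ℝ × Euc d => ‖fderiv ℝ k (x + p.1 • h - p.2)‖)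
      ((volume.restrict (Set.uIoc 0 1)).prod volume) := by
    refine (integrable_prod_iff c1.norm.aestronglyMeasurable).2
      ⟨.of_forall fun s => hDk.comp_sub_left (x + s • h), ?_⟩
    have hs : ∀ s : ℝ, ∫ y, ‖‖fderiv ℝ k (x + s • h - y)‖‖ = ∫ y, ‖fderiv ℝ k y‖ := fun s => by
      simpa only [norm_norm] using
        integral_sub_left_eq_self (fun y => ‖fderiv ℝ k y‖) volume (x + s • h)
    have : IsFiniteMeasure (volume.restrict (Set.uIoc (0 : ℝ) 1)) := by
      rw [Set.uIoc_of_le zero_le_one]; infer_instance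
    exact (integrable_const (∫ y, ‖fderiv ℝ k y‖)).congr (.of_forall fun s => (hs s).symm)
  have c2 : Continuous (Function.uncurry fun (s : ℝ) (y : Euc d) =>
      (w y • fderiv ℝ k (x + s • h - y)) h) :=
    ((hw.comp continuous_snd).smul c1).clm_apply continuous_const
  refine ((h1.const_mul M).mul_const ‖h‖).mono' c2.aestronglyMeasurable (.of_forall fun p => ?_)
  refine (ContinuousLinearMap.le_opNorm _ _).trans ?_
  rw [norm_smul]
  exact mul_le_mul_of_nonneg_right
    (mul_le_mul_of_nonneg_right (hwM _) (norm_nonneg _)) (norm_nonneg _)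

/-- Differentiation of a convolution of a bounded continuous function with a `C¹` kernel whose
derivative is integrable. -/
lemma hasFDerivAt_integral_smul_sub [CompleteSpace G] {k : Euc d → G} {w : Euc d → ℝ} {M : ℝ}
    (hk : ContDiff ℝ 1 k) (hw : Continuous w) (hwM : ∀ y, |w y| ≤ M)
    (hDk : Integrable fun x => ‖fderiv ℝ k x‖)
    (hint : ∀ x, Integrable fun y => w y • k (x - y)) (x : Euc d) :
    HasFDerivAt (fun x => ∫ y, w y • k (x - y)) (∫ y, w y • fderiv ℝ k (x - y)) x := by
  have ck := hk.continuous_fderiv one_ne_zero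
  set J' : Euc d → Euc d →L[ℝ] G := fun x => ∫ y, w y • fderiv ℝ k (x - y) with hJ'
  have cJ' : Continuous J' := continuous_integral_smul_fderiv_sub hk hw hwM hDk
  have hline : ∀ h : Euc d, (∫ y, w y • k (x + h - y)) - ∫ y, w y • k (x - y) =
      ∫ s in (0 : ℝ)..1, J' (x + s • h) h := by
    intro h
    have hftc : ∀ y, w y • k (x + h - y) - w y • k (x - y) =
        ∫ s in (0 : ℝ)..1, (w y • fderiv ℝ k (x + s • h - y)) h := by
      intro y
      have hd : ∀ s ∈ Set.uIcc (0 : ℝ) 1, HasDerivAt (fun s : ℝ => w y • k (x + s • h - y))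
          ((w y • fderiv ℝ k (x + s • h - y)) h) s := by
        intro s _
        have h2 : HasDerivAt (fun s : ℝ => x + s • h - y) h s := by
          simpa using (((hasDerivAt_id s).smul_const h).const_add x).sub_const y
        exact (((hk.differentiable one_ne_zero _).hasFDerivAt.comp_hasDerivAt s h2).const_smul _)
      rw [intervalIntegral.integral_eq_sub_of_hasDerivAt hd
        (Continuous.intervalIntegrable (by fun_prop) _ _)]
      simp
    rw [← integral_sub (hint _) (hint _)]
    simp only [hftc]
    rw [← intervalIntegral_integral_swap
      (integrable_prod_smul_fderiv_sub hk hw hwM hDk x h)]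
    refine intervalIntegral.integral_congr fun s _ => ?_
    exact (ContinuousLinearMap.integral_apply
      (integrable_smul_fderiv_sub hk hw hwM hDk (x + s • h)) h).symm
  rw [hasFDerivAt_iff_isLittleO_nhds_zero, Asymptotics.isLittleO_iff]
  intro c hc
  obtain ⟨r, hr, hrc⟩ := Metric.continuousAt_iff.1 cJ'.continuousAt c hc
  filter_upwards [Metric.ball_mem_nhds (0 : Euc d) hr] with h hh
  rw [mem_ball_zero_iff] at hh
  have e : ((∫ y, w y • k (x + h - y)) - ∫ y, w y • k (x - y)) - J' x h =
      ∫ s in (0 : ℝ)..1, (J' (x + s • h) h - J' x h) := by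
    rw [hline h, intervalIntegral.integral_sub
      (Continuous.intervalIntegrable (by fun_prop) _ _) (by simp)]
    simp
  rw [e]
  refine (intervalIntegral.norm_integral_le_of_norm_le_const (C := c * ‖h‖) ?_).trans (by simp)
  intro s hs
  rw [Set.uIoc_of_le zero_le_one] at hs
  rw [← sub_apply]
  refine (ContinuousLinearMap.le_opNorm _ _).trans ?_
  gcongr
  rw [← dist_eq_norm]
  refine (hrc ?_).le
  rw [dist_eq_norm, add_sub_cancel_left, norm_smul, Real.norm_of_nonneg hs.1.le]
  nlinarith [hs.2, norm_nonneg h]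

/-- Weak form of `‖∇(a ∗ u)‖₁ ≤ ‖a‖₁ ‖∇u‖₁`. -/
lemma integral_diverg_mul_conv_le {W : Euc d → Euc d} {u a : Euc d → ℝ} {A M : ℝ}
    (hW : ContDiff ℝ 1 W) (hc : HasCompactSupport W) (hWA : ∀ x, ‖W x‖ ≤ A)
    (hu : ContDiff ℝ 1 u) (huM : ∀ x, |u x| ≤ M) (hDu : Integrable fun x => ‖fderiv ℝ u x‖)
    (ha : Integrable a) :
    ∫ x, diverg W x * ∫ y, u y * a (x - y) ≤
      A * (∫ x, |a x|) * ∫ x, ‖fderiv ℝ u x‖ := by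
  have cu := hu.continuous
  have cu' := hu.continuous_fderiv one_ne_zero
  have cW := hW.continuous
  have cd := continuous_diverg hW
  have e1 : ∀ x, ∫ y, u y * a (x - y) = ∫ z, u (x - z) * a z := fun x => by
    rw [← integral_sub_left_eq_self (fun z => u (x - z) * a z) volume x]
    simp
  have hprod : Integrable (Function.uncurry fun x z => diverg W x * (u (x - z) * a z))
      (volume.prod volume) := by
    have h1 : Integrable (fun p : Euc d × Euc d => diverg W p.1 * a p.2) (volume.prod volume) :=
      (cd.integrable_of_hasCompactSupport hc.diverg).mul_prod ha
    refine (h1.bdd_mul (f := fun p : Euc d × Euc d => u (p.1 - p.2)) (c := M) (by fun_prop)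
      (.of_forall fun p => huM _)).congr (.of_forall fun p => ?_)
    simp only [Function.uncurry]
    ring
  have e2 : ∀ z, ∫ x, diverg W x * (u (x - z) * a z) =
      -(a z * ∫ x, fderiv ℝ u (x - z) (W x)) := by
    intro z
    have hsh : ContDiff ℝ 1 fun x => u (x - z) := hu.comp (contDiff_id.sub contDiff_const)
    have := integral_diverg_mul hW hc hsh
    simp only [fderiv_comp_sub] at this
    rw [← mul_neg, ← this, ← integral_const_mul]
    congr 1 with x
    ring
  have e3 : ∀ z, |∫ x, fderiv ℝ u (x - z) (W x)| ≤ A * ∫ x, ‖fderiv ℝ u x‖ := by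
    intro z
    rw [← Real.norm_eq_abs, ← integral_sub_right_eq_self (fun x => ‖fderiv ℝ u x‖) z,
      ← integral_const_mul]
    refine norm_integral_le_of_norm_le ((hDu.comp_sub_right z).const_mul A)
      (.of_forall fun x => ?_)
    refine (ContinuousLinearMap.le_opNorm _ _).trans ?_
    rw [mul_comm]
    gcongr
    exact hWA x
  calc _ = ∫ x, ∫ z, diverg W x * (u (x - z) * a z) := by
        simp only [e1, integral_const_mul]
    _ = ∫ z, -(a z * ∫ x, fderiv ℝ u (x - z) (W x)) := by
        rw [integral_integral_swap hprod]
        simp only [e2]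
    _ ≤ ‖∫ z, -(a z * ∫ x, fderiv ℝ u (x - z) (W x))‖ := Real.le_norm_self _
    _ ≤ ∫ z, |a z| * (A * ∫ x, ‖fderiv ℝ u x‖) := by
        refine norm_integral_le_of_norm_le (ha.abs.mul_const _) (.of_forall fun z => ?_)
        rw [norm_neg, norm_mul, Real.norm_eq_abs, Real.norm_eq_abs]
        exact mul_le_mul_of_nonneg_left (e3 z) (abs_nonneg _)
    _ = _ := by rw [integral_mul_const]; ring

end Convolution

section Gradient

variable {d : ℕ} {u : Euc d → ℝ}

lemma norm_gradient (u : Euc d → ℝ) (x : Euc d) : ‖gradient u x‖ = ‖fderiv ℝ u x‖ :=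
  LinearIsometryEquiv.norm_map _ _

lemma contDiff_gradient {m n : WithTop ℕ∞} (hu : ContDiff ℝ n u) (hmn : m + 1 ≤ n) :
    ContDiff ℝ m (gradient u) :=
  ((InnerProductSpace.toDual ℝ (Euc d)).symm.contDiff).comp (hu.fderiv_right hmn)

lemma inner_fderiv_gradient_left (hu : ContDiff ℝ 2 u) (x v w : Euc d) :
    ⟪fderiv ℝ (gradient u) x v, w⟫ = fderiv ℝ (fderiv ℝ u) x v w := by
  have h1 : DifferentiableAt ℝ (gradient u) x :=
    (contDiff_gradient (m := 1) hu (by norm_num)).differentiable one_ne_zero x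
  have h2 : DifferentiableAt ℝ (fderiv ℝ u) x :=
    (hu.fderiv_right (m := 1) (by norm_num)).differentiable one_ne_zero x
  have e : (fun y => ⟪gradient u y, w⟫) = fun y => fderiv ℝ u y w :=
    funext fun y => inner_gradient_left
  have e1 := (h1.hasFDerivAt.inner ℝ (hasFDerivAt_const w x)).fderiv
  have e2 := (h2.hasFDerivAt.clm_apply (hasFDerivAt_const w x)).fderiv
  rw [e, e2] at e1
  simpa using (DFunLike.congr_fun e1 v).symm

lemma fderiv_fderiv_symm (hu : ContDiff ℝ 2 u) (x v w : Euc d) :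
    fderiv ℝ (fderiv ℝ u) x v w = fderiv ℝ (fderiv ℝ u) x w v :=
  hu.contDiffAt.isSymmSndFDerivAt (by simp) v w

lemma hasFDerivAt_fderiv_apply (hu : ContDiff ℝ 2 u) {Z : Euc d → Euc d} {x : Euc d}
    {Z' : Euc d →L[ℝ] Euc d} (hZ : HasFDerivAt Z Z' x) (v : Euc d) :
    DifferentiableAt ℝ (fun y => fderiv ℝ u y (Z y)) x ∧
      fderiv ℝ (fun y => fderiv ℝ u y (Z y)) x v =
        fderiv ℝ (fderiv ℝ u) x v (Z x) + fderiv ℝ u x (Z' v) := by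
  have h2 : DifferentiableAt ℝ (fderiv ℝ u) x :=
    (hu.fderiv_right (m := 1) (by norm_num)).differentiable one_ne_zero x
  have e2 := h2.hasFDerivAt.clm_apply hZ
  refine ⟨e2.differentiableAt, ?_⟩
  rw [e2.fderiv]
  simp [add_comm]

lemma lap_eq_sum (hu : ContDiff ℝ 2 u) (x : Euc d) :
    lap u x = ∑ i, fderiv ℝ (fderiv ℝ u) x (EuclideanSpace.single i 1)
      (EuclideanSpace.single i 1) := by
  refine Finset.sum_congr rfl fun i _ => ?_
  have := (hasFDerivAt_fderiv_apply hu (hasFDerivAt_const (EuclideanSpace.single i (1 : ℝ)) x)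
    (EuclideanSpace.single i 1)).2
  simpa using this

lemma diverg_gradient (hu : ContDiff ℝ 2 u) (x : Euc d) : diverg (gradient u) x = lap u x := by
  simp only [lap_eq_sum hu, diverg, inner_fderiv_gradient_left hu]

lemma contDiff_lap (hu : ContDiff ℝ 3 u) : ContDiff ℝ 1 (lap u) := by
  have h1 : ContDiff ℝ 2 (fderiv ℝ u) := hu.fderiv_right (by norm_num)
  have h2 : ContDiff ℝ 1 (fderiv ℝ (fderiv ℝ u)) := h1.fderiv_right (by norm_num)
  rw [funext (lap_eq_sum (hu.of_le (by norm_num)))]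
  exact ContDiff.sum fun i _ => (h2.clm_apply contDiff_const).clm_apply contDiff_const

lemma fderiv_lap (hu : ContDiff ℝ 3 u) (x v : Euc d) :
    fderiv ℝ (lap u) x v = ∑ i, fderiv ℝ (fderiv ℝ (fderiv ℝ u)) x
      (EuclideanSpace.single i 1) (EuclideanSpace.single i 1) v := by
  have hu2 : ContDiff ℝ 2 u := hu.of_le (by norm_num)
  have h1 : ContDiff ℝ 2 (fderiv ℝ u) := hu.fderiv_right (by norm_num)
  have h2 : ContDiff ℝ 1 (fderiv ℝ (fderiv ℝ u)) := h1.fderiv_right (by norm_num)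
  have hb : ∀ b c : Euc d, HasFDerivAt (fun y => fderiv ℝ (fderiv ℝ u) y b c)
      (((fderiv ℝ (fderiv ℝ (fderiv ℝ u)) x).flip b).flip c) x := by
    intro b c
    have := ((h2.differentiable one_ne_zero x).hasFDerivAt.clm_apply
      (hasFDerivAt_const b x)).clm_apply (hasFDerivAt_const c x)
    refine this.congr_fderiv ?_
    ext w; simp
  have hs1 : ∀ a b c, fderiv ℝ (fderiv ℝ (fderiv ℝ u)) x a b c =
      fderiv ℝ (fderiv ℝ (fderiv ℝ u)) x a c b := by
    intro a b c
    have e : (fun y => fderiv ℝ (fderiv ℝ u) y b c) = fun y => fderiv ℝ (fderiv ℝ u) y c b :=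
      funext fun y => fderiv_fderiv_symm hu2 y b c
    have := hb b c
    rw [e] at this
    simpa using DFunLike.congr_fun (this.unique (hb c b)) a
  have hs2 : ∀ a b, fderiv ℝ (fderiv ℝ (fderiv ℝ u)) x a b =
      fderiv ℝ (fderiv ℝ (fderiv ℝ u)) x b a := fun a b =>
    h1.contDiffAt.isSymmSndFDerivAt (by simp) a b
  rw [funext (lap_eq_sum hu2)]
  rw [(HasFDerivAt.fun_sum fun i _ => hb _ _).fderiv]
  simp only [sum_apply, ContinuousLinearMap.flip_apply]
  refine Finset.sum_congr rfl fun i _ => ?_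
  rw [hs2, hs1]

variable {δ : ℝ}

lemma contDiff_smoothNorm_gradient (hδ : 0 < δ) {m n : WithTop ℕ∞} (hu : ContDiff ℝ n u)
    (hmn : m + 1 ≤ n) : ContDiff ℝ m fun x => smoothNorm δ (gradient u x) :=
  (contDiff_smoothNorm hδ).comp (contDiff_gradient hu hmn)

lemma contDiff_smoothDir_gradient (hδ : 0 < δ) {m n : WithTop ℕ∞} (hu : ContDiff ℝ n u)
    (hmn : m + 1 ≤ n) : ContDiff ℝ m fun x => smoothDir δ (gradient u x) :=
  (contDiff_smoothDir hδ).comp (contDiff_gradient hu hmn)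

lemma fderiv_smoothNorm_gradient (hδ : 0 < δ) (hu : ContDiff ℝ 2 u) (x v : Euc d) :
    fderiv ℝ (fun x => smoothNorm δ (gradient u x)) x v =
      fderiv ℝ (fderiv ℝ u) x v (smoothDir δ (gradient u x)) := by
  have h1 : DifferentiableAt ℝ (gradient u) x :=
    (contDiff_gradient (m := 1) hu (by norm_num)).differentiable one_ne_zero x
  have := ((hasFDerivAt_smoothNorm hδ (gradient u x)).comp x h1.hasFDerivAt).fderiv
  rw [show (fun x => smoothNorm δ (gradient u x)) = smoothNorm δ ∘ gradient u from rfl, this]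
  simp [← inner_fderiv_gradient_left hu, real_inner_comm]

/-- Kato-type inequality: convexity of the regularised norm makes diffusion dissipative. -/
lemma fderiv_lap_smoothDir_le (hδ : 0 < δ) (hu : ContDiff ℝ 3 u) (x : Euc d) :
    fderiv ℝ (lap u) x (smoothDir δ (gradient u x)) ≤
      lap (fun x => smoothNorm δ (gradient u x)) x := by
  have hu2 : ContDiff ℝ 2 u := hu.of_le (by norm_num)
  have h1 : ContDiff ℝ 2 (fderiv ℝ u) := hu.fderiv_right (by norm_num)
  have h2 : ContDiff ℝ 1 (fderiv ℝ (fderiv ℝ u)) := h1.fderiv_right (by norm_num)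
  rw [fderiv_lap hu, lap]
  refine Finset.sum_le_sum fun i _ => ?_
  set e : Euc d := EuclideanSpace.single i (1 : ℝ)
  have hP : DifferentiableAt ℝ (gradient u) x :=
    (contDiff_gradient (m := 1) hu2 (by norm_num)).differentiable one_ne_zero x
  have hn : HasFDerivAt (fun y => smoothDir δ (gradient u y)) _ x :=
    (((contDiff_smoothDir (n := 1) hδ).differentiable one_ne_zero
      (gradient u x)).hasFDerivAt).comp x hP.hasFDerivAt
  have := (((h2.differentiable one_ne_zero x).hasFDerivAt.clm_apply
    (hasFDerivAt_const e x)).clm_apply hn).fderiv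
  simp only [fderiv_smoothNorm_gradient hδ hu2]
  rw [this]
  have hnn := inner_fderiv_smoothDir_nonneg hδ (gradient u x) (fderiv ℝ (gradient u) x e)
  rw [real_inner_comm, inner_fderiv_gradient_left hu2] at hnn
  simpa using hnn

lemma integral_mul_lap {χ q : Euc d → ℝ} (hχ : ContDiff ℝ 1 χ) (hc : HasCompactSupport χ)
    (hq : ContDiff ℝ 2 q) :
    ∫ x, χ x * lap q x = -∫ x, fderiv ℝ χ x (gradient q x) := by
  have hg : ContDiff ℝ 1 (gradient q) := contDiff_gradient hq (by norm_num)
  have cg := hg.continuous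
  have cχ := hχ.continuous
  have cχ' := hχ.continuous_fderiv one_ne_zero
  have cl : Continuous (lap q) := by
    rw [← funext (diverg_gradient hq)]; exact continuous_diverg hg
  have h := integral_diverg_mul (hχ.smul hg) hc.smul_right
    (contDiff_const (c := (1 : ℝ)))
  simp only [mul_one, fderiv_fun_const, Pi.zero_apply, zero_apply, integral_zero, neg_zero] at h
  have e : ∀ x, diverg (fun z => χ z • gradient q z) x =
      χ x * lap q x + fderiv ℝ χ x (gradient q x) := fun x => by
    rw [diverg_smul (hχ.differentiable one_ne_zero x) (hg.differentiable one_ne_zero x),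
      diverg_gradient hq]
  rw [show (χ • gradient q) = fun z => χ z • gradient q z from rfl, funext e,
    integral_add] at h
  · linarith
  · exact Continuous.integrable_of_hasCompactSupport (by fun_prop) hc.mul_right
  · exact Continuous.integrable_of_hasCompactSupport (by fun_prop)
      (HasCompactSupport.intro (hc.fderiv ℝ) fun x hx => by
        simp [image_eq_zero_of_notMem_tsupport hx])

/-- The contribution of the diffusion to the growth of the localised total variation. -/
lemma neg_integral_diverg_mul_lap_le (hδ : 0 < δ) (hu : ContDiff ℝ 3 u) {χ g : Euc d → ℝ}
    {c : ℝ} (hχ : ContDiff ℝ 1 χ) (hc : HasCompactSupport χ) (hχ0 : ∀ x, 0 ≤ χ x)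
    (hχc : ∀ x, ‖fderiv ℝ χ x‖ ≤ c) (hg : Integrable g)
    (hug : ∀ x, ‖fderiv ℝ (fderiv ℝ u) x‖ ≤ g x) :
    -∫ x, diverg (fun z => χ z • smoothDir δ (gradient u z)) x * lap u x ≤ c * ∫ x, g x := by
  have hu2 : ContDiff ℝ 2 u := hu.of_le (by norm_num)
  have hn : ContDiff ℝ 1 fun x => smoothDir δ (gradient u x) :=
    contDiff_smoothDir_gradient hδ hu2 (by norm_num)
  have hq : ContDiff ℝ 2 fun x => smoothNorm δ (gradient u x) :=
    contDiff_smoothNorm_gradient hδ hu (by norm_num)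
  have hl := contDiff_lap hu
  have cl' := hl.continuous_fderiv one_ne_zero
  have cn := hn.continuous
  have cχ := hχ.continuous
  have clq : Continuous (lap fun x => smoothNorm δ (gradient u x)) := by
    rw [← funext (diverg_gradient hq)]
    exact continuous_diverg (contDiff_gradient hq (by norm_num))
  have hW : ContDiff ℝ 1 fun z => χ z • smoothDir δ (gradient u z) := hχ.smul hn
  have hWc : HasCompactSupport fun z => χ z • smoothDir δ (gradient u z) := hc.smul_right
  rw [integral_diverg_mul hW hWc hl, neg_neg]
  calc ∫ x, fderiv ℝ (lap u) x (χ x • smoothDir δ (gradient u x))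
      ≤ ∫ x, χ x * lap (fun x => smoothNorm δ (gradient u x)) x := by
        refine integral_mono
          (Continuous.integrable_of_hasCompactSupport (by fun_prop)
            (HasCompactSupport.intro hc fun x hx => by
              simp [image_eq_zero_of_notMem_tsupport hx]))
          (Continuous.integrable_of_hasCompactSupport (by fun_prop) hc.mul_right) fun x => ?_
        simp only [map_smul, smul_eq_mul]
        exact mul_le_mul_of_nonneg_left (fderiv_lap_smoothDir_le hδ hu x) (hχ0 x)
    _ = -∫ x, fderiv ℝ χ x (gradient (fun x => smoothNorm δ (gradient u x)) x) :=
        integral_mul_lap hχ hc hq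
    _ ≤ ‖∫ x, fderiv ℝ χ x (gradient (fun x => smoothNorm δ (gradient u x)) x)‖ :=
        neg_le_abs _
    _ ≤ ∫ x, c * g x := by
        refine norm_integral_le_of_norm_le (hg.const_mul c) (.of_forall fun x => ?_)
        refine ((fderiv ℝ χ x).le_opNorm _).trans
          (mul_le_mul (hχc x) ?_ (norm_nonneg _) ((norm_nonneg _).trans (hχc x)))
        rw [norm_gradient]
        have hgx : 0 ≤ g x := le_trans (norm_nonneg (fderiv ℝ (fderiv ℝ u) x)) (hug x)
        refine ContinuousLinearMap.opNorm_le_bound _ hgx fun v => ?_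
        rw [fderiv_smoothNorm_gradient hδ hu2]
        refine (ContinuousLinearMap.le_opNorm _ _).trans ?_
        have h1 := (fderiv ℝ (fderiv ℝ u) x).le_opNorm v
        have h2 := norm_smoothDir_le hδ (gradient u x)
        calc _ ≤ ‖fderiv ℝ (fderiv ℝ u) x v‖ * 1 := by gcongr
          _ ≤ g x * ‖v‖ := by
            rw [mul_one]; exact h1.trans (by gcongr; exact hug x)
    _ = c * ∫ x, g x := integral_const_mul _ _

end Gradient

section Transport

variable {d : ℕ} {δ : ℝ} {u χ a : Euc d → ℝ}

lemma diverg_comp_smul {f : ℝ → ℝ} (hf : ContDiff ℝ 2 f) {F : Euc d → Euc d}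
    (hu : ContDiff ℝ 2 u) (hF : ContDiff ℝ 1 F) (x : Euc d) :
    diverg (fun z => f (u z) • F z) x =
      f (u x) * diverg F x + deriv f (u x) * fderiv ℝ u x (F x) := by
  have h1 : HasFDerivAt (fun z => f (u z)) (deriv f (u x) • fderiv ℝ u x) x :=
    (hf.differentiable two_ne_zero (u x)).hasDerivAt.comp_hasFDerivAt x
      (hu.differentiable two_ne_zero x).hasFDerivAt
  rw [diverg_smul h1.differentiableAt (hF.differentiable one_ne_zero x), h1.fderiv]
  simp

set_option maxHeartbeats 400000 in
/-- The contribution of the transport term to the growth of the localised total variation. -/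
lemma integral_diverg_mul_transport_le {f : ℝ → ℝ} {F : Euc d → Euc d} {g : Euc d → ℝ}
    {A₀ A₁ A₂ B C D M c : ℝ} (hδ : 0 < δ) (hf : ContDiff ℝ 2 f) (hu : ContDiff ℝ 2 u)
    (huM : ∀ x, |u x| ≤ M) (hχ : ContDiff ℝ 1 χ) (hc : HasCompactSupport χ)
    (hχ0 : ∀ x, 0 ≤ χ x) (hχ1 : ∀ x, χ x ≤ 1) (hχc : ∀ x, ‖fderiv ℝ χ x‖ ≤ c)
    (hF : ContDiff ℝ 1 F) (hFC : ∀ x, ‖F x‖ ≤ C) (hFB : ∀ x, ‖fderiv ℝ F x‖ ≤ B)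
    (ha : Integrable a) (hFa : ∀ x, diverg F x = ∫ y, u y * a (x - y))
    (hFD : ∀ x, |diverg F x| ≤ D)
    (hA₀ : ∀ x, |f (u x)| ≤ A₀) (hA₁ : ∀ x, |deriv f (u x)| ≤ A₁)
    (hA₂ : ∀ x, |deriv (deriv f) (u x)| ≤ A₂) (hg : Integrable g)
    (hug : ∀ x, ‖fderiv ℝ u x‖ ≤ g x) :
    ∫ x, diverg (fun z => χ z • smoothDir δ (gradient u z)) x *
        diverg (fun z => f (u z) • F z) x ≤
      (A₀ * (∫ x, |a x|) + A₁ * B) * (∫ x, ‖fderiv ℝ u x‖) +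
        c * (A₁ * C * ∫ x, g x) + δ * (A₂ * C * (∫ x, g x) + A₁ * D * ∫ x, χ x) := by
  have hA₀' : 0 ≤ A₀ := (abs_nonneg _).trans (hA₀ 0)
  have hA₁' : 0 ≤ A₁ := (abs_nonneg _).trans (hA₁ 0)
  have hA₂' : 0 ≤ A₂ := (abs_nonneg _).trans (hA₂ 0)
  have hC' : 0 ≤ C := (norm_nonneg _).trans (hFC 0)
  have hc' : 0 ≤ c := (norm_nonneg _).trans (hχc 0)
  set n : Euc d → Euc d := fun z => smoothDir δ (gradient u z) with hn_def
  set η : Euc d → ℝ := fun z => smoothNorm δ (gradient u z) with hη_def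
  set f₁ : Euc d → ℝ := fun z => deriv f (u z) with hf₁_def
  set q : Euc d → ℝ := fun z => f₁ z * fderiv ℝ u z (F z) with hq_def
  have hn : ContDiff ℝ 1 n := contDiff_smoothDir_gradient hδ hu (by norm_num)
  have hη : ContDiff ℝ 1 η := contDiff_smoothNorm_gradient hδ hu (by norm_num)
  have hn1 : ∀ x, ‖n x‖ ≤ 1 := fun x => norm_smoothDir_le hδ _
  have hu1 : ContDiff ℝ 1 u := hu.of_le (by norm_num)
  have hDu : ContDiff ℝ 1 (fderiv ℝ u) := hu.fderiv_right (by norm_num)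
  have hf' : ContDiff ℝ 1 (deriv f) := by
    have : ContDiff ℝ (1 + 1) f := by simpa [one_add_one_eq_two] using hf
    exact (contDiff_succ_iff_deriv.1 this).2.2
  have hf₁ : ContDiff ℝ 1 f₁ := hf'.comp hu1
  have hq : ContDiff ℝ 1 q := hf₁.mul (hDu.clm_apply hF)
  have hfu : ContDiff ℝ 1 fun z => f (u z) := (hf.of_le (by norm_num)).comp hu1
  have dfu : ∀ x, HasFDerivAt (fun z => f (u z)) (f₁ x • fderiv ℝ u x) x := fun x =>
    (hf.differentiable two_ne_zero (u x)).hasDerivAt.comp_hasFDerivAt x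
      (hu.differentiable two_ne_zero x).hasFDerivAt
  have df₁ : ∀ x, HasFDerivAt f₁ (deriv (deriv f) (u x) • fderiv ℝ u x) x := fun x =>
    (hf'.differentiable one_ne_zero (u x)).hasDerivAt.comp_hasFDerivAt x
      (hu.differentiable two_ne_zero x).hasFDerivAt
  set W₁ : Euc d → Euc d := fun z => χ z • n z with hW₁_def
  set W₂ : Euc d → Euc d := fun z => (χ z * f₁ z) • F z with hW₂_def
  set W₃ : Euc d → Euc d := fun z => f (u z) • W₁ z with hW₃_def
  have hW₁ : ContDiff ℝ 1 W₁ := ContDiff.smul hχ hn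
  have hχf : ContDiff ℝ 1 fun z => χ z * f₁ z := ContDiff.mul hχ hf₁
  have hW₂ : ContDiff ℝ 1 W₂ := ContDiff.smul hχf hF
  have hW₃ : ContDiff ℝ 1 W₃ := ContDiff.smul hfu hW₁
  have cW₁ : HasCompactSupport W₁ := HasCompactSupport.intro hc fun x hx => by
    simp [hW₁_def, image_eq_zero_of_notMem_tsupport hx]
  have cW₂ : HasCompactSupport W₂ := HasCompactSupport.intro hc fun x hx => by
    simp [hW₂_def, image_eq_zero_of_notMem_tsupport hx]
  have cW₃ : HasCompactSupport W₃ := HasCompactSupport.intro cW₁ fun x hx => by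
    simp [hW₃_def, image_eq_zero_of_notMem_tsupport hx]
  have c1 := hW₁.continuous
  have c2 := hW₂.continuous
  have c4 := continuous_diverg hW₁
  have c5 := continuous_diverg hW₂
  have c6 := continuous_diverg hF
  have c7 := hq.continuous
  have c8 := hq.continuous_fderiv one_ne_zero
  have c9 := hη.continuous
  have c10 := hη.continuous_fderiv one_ne_zero
  have c11 := hf₁.continuous
  have c12 := hDu.continuous
  have c13 := continuous_diverg hW₃
  have cχ := hχ.continuous
  have I1 : Integrable fun x => diverg W₁ x * q x :=
    Continuous.integrable_of_hasCompactSupport (by fun_prop) cW₁.diverg.mul_right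
  have I2 : Integrable fun x => diverg W₃ x * diverg F x :=
    Continuous.integrable_of_hasCompactSupport (by fun_prop) cW₃.diverg.mul_right
  have I3 : Integrable fun x => f₁ x * fderiv ℝ u x (W₁ x) * diverg F x :=
    Continuous.integrable_of_hasCompactSupport (by fun_prop)
      (HasCompactSupport.intro cW₁ fun x hx => by simp [image_eq_zero_of_notMem_tsupport hx])
  have I4 : Integrable fun x => fderiv ℝ q x (W₁ x) :=
    Continuous.integrable_of_hasCompactSupport (by fun_prop)
      (HasCompactSupport.intro cW₁ fun x hx => by simp [image_eq_zero_of_notMem_tsupport hx])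
  have I5 : Integrable fun x => diverg W₂ x * η x :=
    Continuous.integrable_of_hasCompactSupport (by fun_prop) cW₂.diverg.mul_right
  have I6 : Integrable fun x => fderiv ℝ η x (W₂ x) :=
    Continuous.integrable_of_hasCompactSupport (by fun_prop)
      (HasCompactSupport.intro cW₂ fun x hx => by simp [image_eq_zero_of_notMem_tsupport hx])
  have Iχ : Integrable χ := cχ.integrable_of_hasCompactSupport hc
  have IDu : Integrable fun x => ‖fderiv ℝ u x‖ :=
    hg.mono' c12.norm.aestronglyMeasurable (.of_forall fun x => by
      rw [norm_norm]; exact hug x)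
  have e1 : ∀ x, diverg W₁ x * diverg (fun z => f (u z) • F z) x =
      diverg W₁ x * q x + (diverg W₃ x * diverg F x -
        f₁ x * fderiv ℝ u x (W₁ x) * diverg F x) := by
    intro x
    rw [diverg_comp_smul hf hu hF, hW₃_def,
      diverg_smul (dfu x).differentiableAt (hW₁.differentiable one_ne_zero x), (dfu x).fderiv]
    simp only [smul_apply, smul_eq_mul, hq_def]
    ring
  have hR : ∀ x, -(fderiv ℝ q x (W₁ x)) - f₁ x * fderiv ℝ u x (W₁ x) * diverg F x +
      diverg W₂ x * η x + fderiv ℝ η x (W₂ x) =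
      f₁ x * fderiv ℝ χ x (F x) * η x +
        χ x * (deriv (deriv f) (u x) * fderiv ℝ u x (F x) + f₁ x * diverg F x) *
          (η x - fderiv ℝ u x (n x)) - χ x * f₁ x * fderiv ℝ u x (fderiv ℝ F x (n x)) := by
    intro x
    have hχx := hχ.differentiable one_ne_zero x
    have hFx := (hF.differentiable one_ne_zero x).hasFDerivAt
    obtain ⟨q1, q2⟩ := hasFDerivAt_fderiv_apply hu hFx (n x)
    have eq : fderiv ℝ q x (n x) = deriv (deriv f) (u x) * fderiv ℝ u x (n x) *
        fderiv ℝ u x (F x) + f₁ x * (fderiv ℝ (fderiv ℝ u) x (n x) (F x) +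
          fderiv ℝ u x (fderiv ℝ F x (n x))) := by
      have hm : HasFDerivAt (fun z => f₁ z * fderiv ℝ u z (F z)) _ x :=
        (df₁ x).mul q1.hasFDerivAt
      rw [hq_def, hm.fderiv]
      simp only [add_apply, smul_apply, smul_eq_mul, q2]
      ring
    have ed : diverg W₂ x = χ x * f₁ x * diverg F x + (χ x * (deriv (deriv f) (u x) *
        fderiv ℝ u x (F x)) + f₁ x * fderiv ℝ χ x (F x)) := by
      have hm := hχx.hasFDerivAt.mul (df₁ x)
      rw [hW₂_def, diverg_smul (φ := fun z => χ z * f₁ z) hm.differentiableAt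
        hFx.differentiableAt]
      rw [show (fun z => χ z * f₁ z) = χ * f₁ from rfl, hm.fderiv]
      simp only [add_apply, smul_apply, smul_eq_mul]
    have eη : fderiv ℝ η x (F x) = fderiv ℝ (fderiv ℝ u) x (n x) (F x) := by
      rw [hη_def, fderiv_smoothNorm_gradient hδ hu, fderiv_fderiv_symm hu]
    rw [ed]
    simp only [hW₁_def, hW₂_def, map_smul, smul_eq_mul, eq, eη]
    ring
  have hRle : ∀ x, -(fderiv ℝ q x (W₁ x)) - f₁ x * fderiv ℝ u x (W₁ x) * diverg F x +
      diverg W₂ x * η x + fderiv ℝ η x (W₂ x) ≤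
      c * (A₁ * C * g x) + δ * (A₂ * C * g x + A₁ * D * χ x) +
        A₁ * B * ‖fderiv ℝ u x‖ := by
    intro x
    rw [hR]
    have hgx : 0 ≤ g x := (norm_nonneg _).trans (hug x)
    have hDx : 0 ≤ D := (abs_nonneg _).trans (hFD x)
    have hBx : 0 ≤ B := (norm_nonneg _).trans (hFB x)
    have hη0 : 0 ≤ η x := smoothNorm_nonneg _
    have hηg : η x ≤ g x := (smoothNorm_le_norm hδ _).trans
      ((norm_gradient u x).trans_le (hug x))
    have hin : fderiv ℝ u x (n x) = ⟪n x, gradient u x⟫ := by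
      rw [real_inner_comm, inner_gradient_left]
    have b1 : |f₁ x * fderiv ℝ χ x (F x) * η x| ≤ A₁ * (c * C) * g x := by
      rw [abs_mul, abs_mul, abs_of_nonneg hη0]
      gcongr
      · exact hA₁ x
      · exact ((fderiv ℝ χ x).le_opNorm _).trans
          (mul_le_mul (hχc x) (hFC x) (norm_nonneg _) hc')
    have b2 : |η x - fderiv ℝ u x (n x)| ≤ δ := by
      rw [hin, abs_le]
      have := smoothNorm_le_inner hδ (gradient u x)
      have := inner_le_smoothNorm_add hδ (gradient u x)
      constructor <;> simp only [hη_def, hn_def] <;> linarith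
    have b3 : |deriv (deriv f) (u x) * fderiv ℝ u x (F x) + f₁ x * diverg F x| ≤
        A₂ * (g x * C) + A₁ * D := by
      refine (abs_add_le _ _).trans ?_
      rw [abs_mul, abs_mul]
      gcongr
      · exact hA₂ x
      · exact ((fderiv ℝ u x).le_opNorm _).trans
          (mul_le_mul (hug x) (hFC x) (norm_nonneg _) hgx)
      · exact hA₁ x
      · exact hFD x
    have b4 : |χ x * (deriv (deriv f) (u x) * fderiv ℝ u x (F x) + f₁ x * diverg F x) *
          (η x - fderiv ℝ u x (n x))| ≤ χ x * (A₂ * (g x * C) + A₁ * D) * δ := by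
      rw [abs_mul, abs_mul, abs_of_nonneg (hχ0 x)]
      have := hχ0 x
      gcongr
    have b5 : |χ x * f₁ x * fderiv ℝ u x (fderiv ℝ F x (n x))| ≤
        1 * A₁ * (‖fderiv ℝ u x‖ * (B * 1)) := by
      rw [abs_mul, abs_mul, abs_of_nonneg (hχ0 x)]
      gcongr
      · exact hχ1 x
      · exact hA₁ x
      · refine ((fderiv ℝ u x).le_opNorm _).trans ?_
        gcongr
        exact ((fderiv ℝ F x).le_opNorm _).trans
          (mul_le_mul (hFB x) (hn1 x) (norm_nonneg _) hBx)
    have b6 : χ x * (A₂ * (g x * C)) ≤ 1 * (A₂ * (g x * C)) := by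
      gcongr
      exact hχ1 x
    have l1 := le_abs_self (f₁ x * fderiv ℝ χ x (F x) * η x)
    have l2 := le_abs_self (χ x * (deriv (deriv f) (u x) * fderiv ℝ u x (F x) +
      f₁ x * diverg F x) * (η x - fderiv ℝ u x (n x)))
    have l3 := neg_abs_le (χ x * f₁ x * fderiv ℝ u x (fderiv ℝ F x (n x)))
    have l4 := mul_le_mul_of_nonneg_left b6 hδ.le
    linarith
  have hW₃A : ∀ x, ‖W₃ x‖ ≤ A₀ := by
    intro x
    simp only [hW₃_def, hW₁_def, norm_smul]
    calc ‖f (u x)‖ * (‖χ x‖ * ‖n x‖) ≤ A₀ * (1 * 1) := by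
          gcongr
          · exact hA₀ x
          · rw [Real.norm_of_nonneg (hχ0 x)]; exact hχ1 x
          · exact hn1 x
      _ = A₀ := by ring
  have key3 := integral_diverg_mul_conv_le hW₃ cW₃ hW₃A hu1 huM IDu ha
  simp only [← hFa] at key3
  have ibp1 := integral_diverg_mul hW₁ cW₁ hq
  have ibp2 := integral_diverg_mul hW₂ cW₂ hη
  have hint : ∫ x, (-(fderiv ℝ q x (W₁ x)) - f₁ x * fderiv ℝ u x (W₁ x) * diverg F x +
      diverg W₂ x * η x + fderiv ℝ η x (W₂ x)) ≤
      c * (A₁ * C * ∫ x, g x) + δ * (A₂ * C * (∫ x, g x) + A₁ * D * ∫ x, χ x) +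
        A₁ * B * ∫ x, ‖fderiv ℝ u x‖ := by
    have J1 : Integrable fun x => c * (A₁ * C * g x) := (hg.const_mul _).const_mul _
    have J2 : Integrable fun x => A₂ * C * g x := hg.const_mul _
    have J3 : Integrable fun x => A₁ * D * χ x := Iχ.const_mul _
    have J4 : Integrable fun x => δ * (A₂ * C * g x + A₁ * D * χ x) := (J2.add J3).const_mul _
    have J5 : Integrable fun x => A₁ * B * ‖fderiv ℝ u x‖ := IDu.const_mul _
    have J6 : Integrable fun x => c * (A₁ * C * g x) +
        δ * (A₂ * C * g x + A₁ * D * χ x) := J1.add J4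
    refine (integral_mono (((I4.neg.sub I3).add I5).add I6) (J6.add J5) hRle).trans_eq ?_
    simp only [Pi.add_apply]
    rw [integral_add J6 J5, integral_add J1 J4, integral_const_mul, integral_const_mul,
      integral_const_mul, integral_const_mul, integral_add J2 J3, integral_const_mul,
      integral_const_mul]
  have L1 : Integrable fun x => -(fderiv ℝ q x (W₁ x)) := I4.neg
  have L2 : Integrable fun x => -(fderiv ℝ q x (W₁ x)) -
      f₁ x * fderiv ℝ u x (W₁ x) * diverg F x := L1.sub I3
  have L3 : Integrable fun x => -(fderiv ℝ q x (W₁ x)) -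
      f₁ x * fderiv ℝ u x (W₁ x) * diverg F x + diverg W₂ x * η x := L2.add I5
  have L4 : Integrable fun x => diverg W₃ x * diverg F x -
      f₁ x * fderiv ℝ u x (W₁ x) * diverg F x := I2.sub I3
  rw [integral_add L3 I6, integral_add L2 I5, integral_sub L1 I3, integral_neg] at hint
  simp only [e1]
  rw [integral_add I1 L4, integral_sub I2 I3]
  linarith

end Transport

section IteratedDerivative

variable {X E G : Type*} [TopologicalSpace X] [NormedAddCommGroup E] [NormedSpace ℝ E]
  [NormedAddCommGroup G] [NormedSpace ℝ G] {u : X → E → G} {s : Set (X × E)}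

lemma continuousOn_of_iteratedFDeriv_zero
    (h : ContinuousOn (fun p : X × E => iteratedFDeriv ℝ 0 (u p.1) p.2) s) :
    ContinuousOn (fun p : X × E => u p.1 p.2) s := by
  have := (continuousMultilinearCurryFin0 ℝ E G).continuous.comp_continuousOn h
  simpa [iteratedFDeriv_zero_eq_comp, Function.comp_def] using this

lemma continuousOn_iteratedFDeriv_fderiv {n : ℕ}
    (h : ContinuousOn (fun p : X × E => iteratedFDeriv ℝ (n + 1) (u p.1) p.2) s) :
    ContinuousOn (fun p : X × E => iteratedFDeriv ℝ n (fderiv ℝ (u p.1)) p.2) s := by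
  have := (continuousMultilinearCurryRightEquiv' ℝ n E G).continuous.comp_continuousOn h
  simpa [iteratedFDeriv_succ_eq_comp_right, Function.comp_def] using this

end IteratedDerivative

section TimeDerivative

open Filter Topology Set

variable {d : ℕ} {δ : ℝ} {χ : Euc d → ℝ}

/-- The divergence of a localised normalised gradient, in terms of the first and second
derivatives. -/
lemma diverg_smul_smoothDir_gradient {u : Euc d → ℝ} (hδ : 0 < δ) (hχ : ContDiff ℝ 1 χ)
    (hu : ContDiff ℝ 2 u) (x : Euc d) :
    diverg (fun z => χ z • smoothDir δ (gradient u z)) x =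
      χ x * ∑ i, ⟪fderiv ℝ (smoothDir δ) ((InnerProductSpace.toDual ℝ (Euc d)).symm
          (fderiv ℝ u x)) ((InnerProductSpace.toDual ℝ (Euc d)).symm
            (fderiv ℝ (fderiv ℝ u) x (EuclideanSpace.single i 1))),
          EuclideanSpace.single i (1 : ℝ)⟫ +
        fderiv ℝ χ x (smoothDir δ ((InnerProductSpace.toDual ℝ (Euc d)).symm
          (fderiv ℝ u x))) := by
  have h2 : DifferentiableAt ℝ (fderiv ℝ u) x :=
    (hu.fderiv_right (m := 1) (by norm_num)).differentiable one_ne_zero x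
  have hP : HasFDerivAt (gradient u) _ x :=
    ((InnerProductSpace.toDual ℝ (Euc d)).symm.toContinuousLinearEquiv.toContinuousLinearMap
      |>.hasFDerivAt).comp x h2.hasFDerivAt
  have hn : HasFDerivAt (fun y => smoothDir δ (gradient u y)) _ x :=
    (((contDiff_smoothDir (n := 1) hδ).differentiable one_ne_zero
      (gradient u x)).hasFDerivAt).comp x hP
  rw [diverg_smul (hχ.differentiable one_ne_zero x) hn.differentiableAt, diverg, hn.fderiv]
  rfl

lemma continuousOn_diverg_smul_smoothDir_gradient {u : ℝ → Euc d → ℝ} {I : Set ℝ} (hδ : 0 < δ)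
    (hχ : ContDiff ℝ 1 χ) (hu : ∀ t ∈ I, ContDiff ℝ 2 (u t))
    (h1 : ContinuousOn (fun p : ℝ × Euc d => fderiv ℝ (u p.1) p.2) (I ×ˢ univ))
    (h2 : ContinuousOn (fun p : ℝ × Euc d => fderiv ℝ (fderiv ℝ (u p.1)) p.2) (I ×ˢ univ)) :
    ContinuousOn (fun p : ℝ × Euc d =>
      diverg (fun z => χ z • smoothDir δ (gradient (u p.1) z)) p.2) (I ×ˢ univ) := by
  have cn : Continuous (smoothDir δ : Euc d → Euc d) := (contDiff_smoothDir (n := 1) hδ).continuous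
  have cn' := (contDiff_smoothDir (V := Euc d) (n := 1) hδ).continuous_fderiv one_ne_zero
  have cχ := hχ.continuous
  have cχ' := hχ.continuous_fderiv one_ne_zero
  have hJ : Continuous (InnerProductSpace.toDual ℝ (Euc d)).symm :=
    (InnerProductSpace.toDual ℝ (Euc d)).symm.continuous
  have hP := hJ.comp_continuousOn h1
  have hM : ∀ i, ContinuousOn (fun p : ℝ × Euc d => (InnerProductSpace.toDual ℝ (Euc d)).symm
      (fderiv ℝ (fderiv ℝ (u p.1)) p.2 (EuclideanSpace.single i 1))) (I ×ˢ univ) := fun i =>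
    hJ.comp_continuousOn (h2.clm_apply continuousOn_const)
  refine (((cχ.comp_continuousOn continuousOn_snd).mul (continuousOn_finsetSum Finset.univ
    fun i _ => ((cn'.comp_continuousOn hP).clm_apply (hM i)).inner
      (continuousOn_const (c := EuclideanSpace.single i (1 : ℝ))))).add
    ((cχ'.comp_continuousOn continuousOn_snd).clm_apply (cn.comp_continuousOn hP))).congr ?_
  rintro ⟨t, x⟩ ⟨ht, -⟩
  exact diverg_smul_smoothDir_gradient hδ hχ (hu t ht) x

lemma continuous_mul_smoothNorm_gradient (hδ : 0 < δ) (hχ : Continuous χ) {u : Euc d → ℝ}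
    (hu : ContDiff ℝ 1 u) : Continuous fun x => χ x * smoothNorm δ (gradient u x) :=
  hχ.mul (contDiff_smoothNorm_gradient (m := 0) hδ hu (by norm_num)).continuous

/-- Convexity of the regularised total variation. -/
lemma neg_integral_diverg_mul_sub_le {u v : Euc d → ℝ} (hδ : 0 < δ) (hχ : ContDiff ℝ 1 χ)
    (hc : HasCompactSupport χ) (hχ0 : ∀ x, 0 ≤ χ x) (hu : ContDiff ℝ 2 u)
    (hv : ContDiff ℝ 2 v) :
    -∫ x, diverg (fun z => χ z • smoothDir δ (gradient u z)) x * (v x - u x) ≤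
      (∫ x, χ x * smoothNorm δ (gradient v x)) - ∫ x, χ x * smoothNorm δ (gradient u x) := by
  have hn : ContDiff ℝ 1 fun x => smoothDir δ (gradient u x) :=
    contDiff_smoothDir_gradient hδ hu (by norm_num)
  have hW : ContDiff ℝ 1 fun z => χ z • smoothDir δ (gradient u z) := hχ.smul hn
  have hWc : HasCompactSupport fun z => χ z • smoothDir δ (gradient u z) := hc.smul_right
  have hu1 : ContDiff ℝ 1 u := hu.of_le (by norm_num)
  have hv1 : ContDiff ℝ 1 v := hv.of_le (by norm_num)
  have hvu : ContDiff ℝ 1 fun x => v x - u x := hv1.sub hu1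
  have cvu := hvu.continuous_fderiv one_ne_zero
  have cW := hW.continuous
  have Iu : Integrable fun x => χ x * smoothNorm δ (gradient u x) :=
    (continuous_mul_smoothNorm_gradient hδ hχ.continuous hu1).integrable_of_hasCompactSupport
      hc.mul_right
  have Iv : Integrable fun x => χ x * smoothNorm δ (gradient v x) :=
    (continuous_mul_smoothNorm_gradient hδ hχ.continuous hv1).integrable_of_hasCompactSupport
      hc.mul_right
  rw [integral_diverg_mul hW hWc hvu, neg_neg, ← integral_sub Iv Iu]
  refine integral_mono (Continuous.integrable_of_hasCompactSupport (by fun_prop)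
    (HasCompactSupport.intro hc fun x hx => by simp [image_eq_zero_of_notMem_tsupport hx]))
    (Iv.sub Iu) fun x => ?_
  have dv := hv1.differentiable one_ne_zero x
  have du := hu1.differentiable one_ne_zero x
  have e : fderiv ℝ (fun x => v x - u x) x (smoothDir δ (gradient u x)) =
      ⟪smoothDir δ (gradient u x), gradient v x - gradient u x⟫ := by
    rw [fderiv_fun_sub dv du, inner_sub_right, real_inner_comm, inner_gradient_left,
      real_inner_comm, inner_gradient_left, sub_apply]
  have := mul_le_mul_of_nonneg_left
    (smoothNorm_add_inner_le hδ (gradient v x) (gradient u x)) (hχ0 x)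
  simp only [map_smul, smul_eq_mul, e]
  linarith

/-- A convex functional of `u s` whose subgradients are represented by compactly supported
functions `H s` has right derivative `-∫ H t * ∂ₜu t`. -/
lemma hasDerivWithinAt_of_subgradient {u ut H : ℝ → Euc d → ℝ} {ψ : ℝ → ℝ} {S : Set (Euc d)}
    {a b t L : ℝ} (hS : IsCompact S) (cu : ∀ s ∈ Icc a b, Continuous (u s))
    (cH : ContinuousOn (fun p : ℝ × Euc d => H p.1 p.2) (Icc a b ×ˢ univ))
    (H0 : ∀ s, ∀ x ∉ S, H s x = 0)
    (hψ : ∀ s ∈ Icc a b, ∀ r ∈ Icc a b, -∫ x, H r x * (u s x - u r x) ≤ ψ s - ψ r)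
    (hut : ∀ s ∈ Ioo a b, ∀ x, HasDerivAt (fun τ => u τ x) (ut s x) s)
    (hL : ∀ s ∈ Ioo a b, ∀ x ∈ S, |ut s x| ≤ L) (ht : t ∈ Ioo a b) :
    HasDerivWithinAt ψ (-∫ x, H t x * ut t x) (Ioi t) t := by
  have ht' := Ioo_subset_Icc_self ht
  obtain ⟨C, hC⟩ := (isCompact_Icc.prod hS).exists_bound_of_continuousOn
    (cH.mono (prod_mono_right (subset_univ _)))
  have hns : ∀ᶠ s in 𝓝[>] t, s ∈ Ioo t b := Ioo_mem_nhdsGT ht.2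
  have hIoo : ∀ s ∈ Ioo t b, s ∈ Icc a b := fun s hs =>
    ⟨(ht.1.trans hs.1).le, hs.2.le⟩
  have hslope : ∀ x, Tendsto (fun s => (s - t)⁻¹ * (u s x - u t x)) (𝓝[>] t) (𝓝 (ut t x)) := by
    intro x
    have hsub : Ioi t ⊆ {t}ᶜ := fun y hy => ne_of_gt hy
    have := (hasDerivAt_iff_tendsto_slope.1 (hut t ht x)).mono_left (nhdsWithin_mono t hsub)
    simpa [slope_fun_def] using this
  have hbound : ∀ s ∈ Ioo t b, ∀ x ∈ S, |(s - t)⁻¹ * (u s x - u t x)| ≤ L := by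
    intro s hs x hx
    have hst : 0 < s - t := sub_pos.2 hs.1
    have := (convex_Ioo a b).norm_image_sub_le_of_norm_hasDerivWithin_le
      (fun r hr => (hut r hr x).hasDerivWithinAt) (fun r hr => hL r hr x hx) ht
      ⟨ht.1.trans hs.1, hs.2⟩
    rw [abs_mul, abs_inv, abs_of_pos hst, inv_mul_le_iff₀ hst]
    simpa [Real.norm_eq_abs, abs_of_pos hst, mul_comm] using this
  have cHs : ∀ s ∈ Icc a b, Continuous (H s) := fun s hs =>
    cH.comp_continuous (Continuous.prodMk_right s) fun x => ⟨hs, mem_univ _⟩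
  have hdom : Integrable ((S).indicator fun _ => C * L) :=
    (integrable_indicator_iff hS.measurableSet).2
      (integrableOn_const hS.measure_lt_top.ne)
  have hlim : ∀ r : ℝ → ℝ, (∀ s ∈ Ioo t b, r s ∈ Icc a b) → Tendsto r (𝓝[>] t) (𝓝[Icc a b] t) →
      Tendsto (fun s => -∫ x, H (r s) x * ((s - t)⁻¹ * (u s x - u t x))) (𝓝[>] t)
        (𝓝 (-∫ x, H t x * ut t x)) := by
    intro r hr hrt
    refine (tendsto_integral_filter_of_dominated_convergence _ ?_ ?_ hdom ?_).neg
    · filter_upwards [hns] with s hs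
      have := cHs _ (hr s hs)
      have := cu s (hIoo s hs)
      have := cu t ht'
      exact Continuous.aestronglyMeasurable (by fun_prop)
    · filter_upwards [hns] with s hs
      refine .of_forall fun x => ?_
      by_cases hx : x ∈ S
      · rw [indicator_of_mem hx, norm_mul]
        exact mul_le_mul (hC (r s, x) ⟨hr s hs, hx⟩) (hbound s hs x hx) (norm_nonneg _)
          ((norm_nonneg _).trans (hC (r s, x) ⟨hr s hs, hx⟩))
      · simp [H0 _ x hx, hx]
    · refine .of_forall fun x => Tendsto.mul ?_ (hslope x)
      have : ContinuousOn (fun s => H s x) (Icc a b) :=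
        cH.comp (Continuous.prodMk_left x).continuousOn fun s hs => ⟨hs, mem_univ _⟩
      exact (this t ht').tendsto.comp hrt
  have hpull : ∀ s (w : Euc d → ℝ), -∫ x, w x * ((s - t)⁻¹ * (u s x - u t x)) =
      (s - t)⁻¹ * -∫ x, w x * (u s x - u t x) := by
    intro s w
    rw [mul_neg, ← integral_const_mul]
    congr 2
    ext x
    ring
  rw [hasDerivWithinAt_iff_tendsto_slope' (by simp)]
  refine tendsto_of_tendsto_of_tendsto_of_le_of_le'
    (hlim (fun _ => t) (fun _ _ => ht')
      (tendsto_nhdsWithin_of_tendsto_nhds_of_eventually_within _ tendsto_const_nhds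
        (.of_forall fun _ => ht')))
    (hlim id hIoo (tendsto_nhdsWithin_of_tendsto_nhds_of_eventually_within _
      (tendsto_id.mono_left nhdsWithin_le_nhds) (hns.mono hIoo))) ?_ ?_
  · filter_upwards [hns] with s hs
    rw [hpull, slope_def_field, div_eq_inv_mul]
    exact mul_le_mul_of_nonneg_left (hψ s (hIoo s hs) t ht') (inv_nonneg.2 (sub_pos.2 hs.1).le)
  · filter_upwards [hns] with s hs
    rw [hpull, slope_def_field, div_eq_inv_mul]
    refine mul_le_mul_of_nonneg_left ?_ (inv_nonneg.2 (sub_pos.2 hs.1).le)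
    have := hψ t ht' s (hIoo s hs)
    have e : ∫ x, H s x * (u t x - u s x) = -∫ x, H s x * (u s x - u t x) := by
      rw [← integral_neg]
      congr 1
      ext x
      ring
    rw [e, neg_neg] at this
    simp only [id]
    linarith

/-- The right derivative of the regularised, localised total variation. -/
lemma hasDerivWithinAt_integral_smoothNorm_gradient {u ut : ℝ → Euc d → ℝ} {a b t L : ℝ}
    (hδ : 0 < δ) (hχ : ContDiff ℝ 1 χ) (hc : HasCompactSupport χ) (hχ0 : ∀ x, 0 ≤ χ x)
    (hu : ∀ s ∈ Icc a b, ContDiff ℝ 2 (u s))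
    (h1 : ContinuousOn (fun p : ℝ × Euc d => fderiv ℝ (u p.1) p.2) (Icc a b ×ˢ univ))
    (h2 : ContinuousOn (fun p : ℝ × Euc d => fderiv ℝ (fderiv ℝ (u p.1)) p.2)
      (Icc a b ×ˢ univ))
    (hut : ∀ s ∈ Ioo a b, ∀ x, HasDerivAt (fun τ => u τ x) (ut s x) s)
    (hL : ∀ s ∈ Ioo a b, ∀ x ∈ tsupport χ, |ut s x| ≤ L) (ht : t ∈ Ioo a b) :
    HasDerivWithinAt (fun s => ∫ x, χ x * smoothNorm δ (gradient (u s) x))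
      (-∫ x, diverg (fun z => χ z • smoothDir δ (gradient (u t) z)) x * ut t x) (Ioi t) t :=
  hasDerivWithinAt_of_subgradient
    (H := fun s => diverg fun z => χ z • smoothDir δ (gradient (u s) z)) hc.isCompact
    (fun s hs => (hu s hs).continuous)
    (continuousOn_diverg_smul_smoothDir_gradient hδ hχ hu h1 h2)
    (fun s x hx => diverg_eq_zero_of_notMem_tsupport fun h => hx (closure_mono (fun y hy => by
      rw [Function.mem_support] at hy ⊢
      exact fun h0 => hy (by simp [h0])) h))
    (fun s hs r hr => neg_integral_diverg_mul_sub_le hδ hχ hc hχ0 (hu r hr) (hu s hs))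
    hut hL ht

end TimeDerivative

section Gronwall

open Filter Topology Set

/-- A Grönwall inequality for a pointwise limit of functions satisfying approximate differential
inequalities. -/
lemma le_exp_integral_mul_of_tendsto {ψ ψ' : ℕ → ℝ → ℝ} {a Φ : ℝ → ℝ} {e : ℕ → ℝ} {t B : ℝ}
    (ht : 0 ≤ t) (hψc : ∀ N, ContinuousOn (ψ N) (Icc 0 t))
    (hψ0 : ∀ N, ∀ s ∈ Icc 0 t, 0 ≤ ψ N s)
    (hψ' : ∀ N, ∀ s ∈ Ioo 0 t, HasDerivWithinAt (ψ N) (ψ' N s) (Ioi s) s)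
    (hle : ∀ N, ∀ s ∈ Ioo 0 t, ψ' N s ≤ a s * Φ s + e N) (he : Tendsto e atTop (𝓝 0))
    (hlim : ∀ s ∈ Icc 0 t, Tendsto (fun N => ψ N s) atTop (𝓝 (Φ s)))
    (ha0 : ∀ s ∈ Icc 0 t, 0 ≤ a s) (ha : IntegrableOn a (Icc 0 t))
    (hΦB : ∀ s ∈ Icc 0 t, Φ s ≤ B) :
    Φ t ≤ exp (∫ s in (0 : ℝ)..t, a s) * Φ 0 := by
  have hΦ0 : ∀ s ∈ Icc 0 t, 0 ≤ Φ s := fun s hs =>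
    ge_of_tendsto' (hlim s hs) fun N => hψ0 N s hs
  have h0t : (0 : ℝ) ∈ Icc 0 t := ⟨le_rfl, ht⟩
  have htt : t ∈ Icc 0 t := ⟨ht, le_rfl⟩
  obtain ⟨E, hE⟩ := he.norm.bddAbove_range
  have hE' : ∀ N, |e N| ≤ E := fun N => hE ⟨N, rfl⟩
  have mψ : ∀ N, AEStronglyMeasurable (ψ N) (volume.restrict (Icc 0 t)) := fun N =>
    (hψc N).aestronglyMeasurable measurableSet_Icc
  have mΦ : AEStronglyMeasurable Φ (volume.restrict (Icc 0 t)) :=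
    aestronglyMeasurable_of_tendsto_ae atTop mψ
      ((ae_restrict_iff' measurableSet_Icc).2 (.of_forall hlim))
  have key : ∀ κ > 0, Φ t + κ ≤ exp (∫ s in (0 : ℝ)..t, a s) * (Φ 0 + κ) := by
    intro κ hκ
    have hpos : ∀ N, ∀ s ∈ Icc 0 t, 0 < ψ N s + κ := fun N s hs => by
      linarith [hψ0 N s hs]
    have hposΦ : ∀ s ∈ Icc 0 t, 0 < Φ s + κ := fun s hs => by linarith [hΦ0 s hs]
    set φ : ℕ → ℝ → ℝ := fun N s => (a s * Φ s + e N) / (ψ N s + κ) with hφ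
    have hbI : IntegrableOn (fun s => (a s * B + E) / κ) (Icc 0 t) :=
      ((ha.mul_const B).add (integrableOn_const (by simp))).div_const κ
    have mφ : ∀ N, AEStronglyMeasurable (φ N) (volume.restrict (Icc 0 t)) := fun N =>
      (((ha.1.mul mΦ).add aestronglyMeasurable_const).aemeasurable.div
        ((mψ N).add aestronglyMeasurable_const).aemeasurable).aestronglyMeasurable
    have hφb : ∀ N, ∀ s ∈ Icc 0 t, ‖φ N s‖ ≤ (a s * B + E) / κ := by
      intro N s hs
      have h1 : |a s * Φ s + e N| ≤ a s * B + E := by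
        refine (abs_add_le _ _).trans (add_le_add ?_ (hE' N))
        rw [abs_of_nonneg (mul_nonneg (ha0 s hs) (hΦ0 s hs))]
        exact mul_le_mul_of_nonneg_left (hΦB s hs) (ha0 s hs)
      rw [hφ, norm_div, Real.norm_eq_abs, Real.norm_of_nonneg (hpos N s hs).le]
      exact div_le_div₀ ((abs_nonneg _).trans h1) h1 hκ (by linarith [hψ0 N s hs])
    have hφI : ∀ N, IntegrableOn (φ N) (Icc 0 t) := fun N =>
      hbI.mono' (mφ N) ((ae_restrict_iff' measurableSet_Icc).2 (.of_forall (hφb N)))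
    have hN : ∀ N, log (ψ N t + κ) - log (ψ N 0 + κ) ≤ ∫ s in (0 : ℝ)..t, φ N s := fun N => by
      refine intervalIntegral.sub_le_integral_of_hasDeriv_right_of_le (g := fun s => log (ψ N s + κ))
        (g' := fun s => ψ' N s / (ψ N s + κ)) ht ?_ ?_ (hφI N) ?_
      · exact ((hψc N).add continuousOn_const).log fun s hs => (hpos N s hs).ne'
      · intro s hs
        exact ((hψ' N s hs).add_const κ).log (hpos N s (Ioo_subset_Icc_self hs)).ne'
      · intro s hs
        exact div_le_div_of_nonneg_right (hle N s hs) (hpos N s (Ioo_subset_Icc_self hs)).le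
    have hlimI : Tendsto (fun N => ∫ s in (0 : ℝ)..t, φ N s) atTop
        (𝓝 (∫ s in (0 : ℝ)..t, a s * Φ s / (Φ s + κ))) := by
      simp only [intervalIntegral.integral_of_le ht, ← integral_Icc_eq_integral_Ioc]
      refine tendsto_integral_of_dominated_convergence _ mφ hbI
        (fun N => (ae_restrict_iff' measurableSet_Icc).2 (.of_forall (hφb N)))
        ((ae_restrict_iff' measurableSet_Icc).2 (.of_forall fun s hs => ?_))
      have := ((tendsto_const_nhds (x := a s * Φ s)).add he).div
        ((hlim s hs).add_const κ) (hposΦ s hs).ne'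
      rw [add_zero] at this
      exact this
    have hlog : ∀ s ∈ Icc 0 t, Tendsto (fun N => log (ψ N s + κ)) atTop
        (𝓝 (log (Φ s + κ))) := fun s hs =>
      ((hlim s hs).add_const κ).log (hposΦ s hs).ne'
    have h1 : log (Φ t + κ) - log (Φ 0 + κ) ≤ ∫ s in (0 : ℝ)..t, a s * Φ s / (Φ s + κ) :=
      le_of_tendsto_of_tendsto' ((hlog t htt).sub (hlog 0 h0t)) hlimI hN
    have haΦ : ∀ s ∈ Icc 0 t, a s * Φ s / (Φ s + κ) ≤ a s := fun s hs => by
      rw [div_le_iff₀ (hposΦ s hs)]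
      exact mul_le_mul_of_nonneg_left (by linarith) (ha0 s hs)
    have haΦ0 : ∀ s ∈ Icc 0 t, 0 ≤ a s * Φ s / (Φ s + κ) := fun s hs =>
      div_nonneg (mul_nonneg (ha0 s hs) (hΦ0 s hs)) (hposΦ s hs).le
    have h2 : ∫ s in (0 : ℝ)..t, a s * Φ s / (Φ s + κ) ≤ ∫ s in (0 : ℝ)..t, a s := by
      have haI : IntervalIntegrable a volume 0 t :=
        (intervalIntegrable_iff_integrableOn_Icc_of_le ht).2 ha
      refine intervalIntegral.integral_mono_on ht ?_ haI haΦ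
      refine (intervalIntegrable_iff_integrableOn_Icc_of_le ht).2 (ha.mono'
        ((ha.1.mul mΦ).aemeasurable.div
          (mΦ.add aestronglyMeasurable_const).aemeasurable).aestronglyMeasurable ?_)
      refine (ae_restrict_iff' measurableSet_Icc).2 (.of_forall fun s hs => ?_)
      rw [Real.norm_of_nonneg (haΦ0 s hs)]
      exact haΦ s hs
    have h3 : log (Φ t + κ) ≤ (∫ s in (0 : ℝ)..t, a s) + log (Φ 0 + κ) := by linarith
    calc Φ t + κ = exp (log (Φ t + κ)) := (exp_log (hposΦ t htt)).symm
      _ ≤ exp ((∫ s in (0 : ℝ)..t, a s) + log (Φ 0 + κ)) := exp_le_exp.2 h3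
      _ = _ := by rw [exp_add, exp_log (hposΦ 0 h0t)]
  have hl : Tendsto (fun κ : ℝ => Φ t + κ) (𝓝[>] 0) (𝓝 (Φ t + 0)) :=
    (Continuous.tendsto (by fun_prop) 0).mono_left nhdsWithin_le_nhds
  have hr : Tendsto (fun κ : ℝ => exp (∫ s in (0 : ℝ)..t, a s) * (Φ 0 + κ)) (𝓝[>] 0)
      (𝓝 (exp (∫ s in (0 : ℝ)..t, a s) * (Φ 0 + 0))) :=
    (Continuous.tendsto (by fun_prop) 0).mono_left nhdsWithin_le_nhds
  simpa using le_of_tendsto_of_tendsto hl hr (eventually_mem_nhdsWithin.mono key)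

end Gronwall

section Force

variable {d : ℕ} {K : Euc d → Euc d} {v : Euc d → ℝ} {M C : ℝ}

lemma integrable_smul_comp_sub (hK : Continuous K) (hKC : ∀ x, ‖K x‖ ≤ C) (hv : Integrable v)
    (x : Euc d) : Integrable fun y => v y • K (x - y) := by
  refine (hv.norm.mul_const C).mono' (hv.1.smul (by fun_prop)) (.of_forall fun y => ?_)
  rw [norm_smul]
  exact mul_le_mul_of_nonneg_left (hKC _) (norm_nonneg _)

lemma norm_integral_smul_comp_sub_le (hKC : ∀ x, ‖K x‖ ≤ C) (hv : Integrable v)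
    (x : Euc d) : ‖∫ y, v y • K (x - y)‖ ≤ C * ∫ y, |v y| := by
  rw [mul_comm, ← integral_mul_const]
  refine norm_integral_le_of_norm_le (hv.norm.mul_const C) (.of_forall fun y => ?_)
  rw [norm_smul]
  exact mul_le_mul_of_nonneg_left (hKC _) (norm_nonneg _)

lemma contDiff_integral_smul_comp_sub (hK : ContDiff ℝ 1 K) (hKC : ∀ x, ‖K x‖ ≤ C)
    (hDK : Integrable fun x => ‖fderiv ℝ K x‖) (hvc : Continuous v) (hvM : ∀ x, |v x| ≤ M)
    (hv : Integrable v) : ContDiff ℝ 1 fun x => ∫ y, v y • K (x - y) := by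
  have h := hasFDerivAt_integral_smul_sub hK hvc hvM hDK
    (integrable_smul_comp_sub hK.continuous hKC hv)
  refine contDiff_one_iff_fderiv.2 ⟨fun x => (h x).differentiableAt, ?_⟩
  rw [funext fun x => (h x).fderiv]
  exact continuous_integral_smul_fderiv_sub hK hvc hvM hDK

lemma norm_fderiv_integral_smul_comp_sub_le (hK : ContDiff ℝ 1 K) (hKC : ∀ x, ‖K x‖ ≤ C)
    (hDK : Integrable fun x => ‖fderiv ℝ K x‖) (hvc : Continuous v) (hvM : ∀ x, |v x| ≤ M)
    (hv : Integrable v) (x : Euc d) :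
    ‖fderiv ℝ (fun x => ∫ y, v y • K (x - y)) x‖ ≤ M * ∫ y, ‖fderiv ℝ K y‖ := by
  rw [(hasFDerivAt_integral_smul_sub hK hvc hvM hDK
    (integrable_smul_comp_sub hK.continuous hKC hv) x).fderiv]
  exact norm_integral_smul_fderiv_sub_le hvM hDK x

lemma diverg_integral_smul_comp_sub (hK : ContDiff ℝ 1 K) (hKC : ∀ x, ‖K x‖ ≤ C)
    (hDK : Integrable fun x => ‖fderiv ℝ K x‖) (hvc : Continuous v) (hvM : ∀ x, |v x| ≤ M)
    (hv : Integrable v) (x : Euc d) :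
    diverg (fun x => ∫ y, v y • K (x - y)) x = ∫ y, v y * diverg K (x - y) := by
  have hI := integrable_smul_fderiv_sub hK hvc hvM hDK x
  have hi : ∀ i : Fin d, Integrable fun y =>
      v y • fderiv ℝ K (x - y) (EuclideanSpace.single i 1) := fun i =>
    hI.apply_continuousLinearMap _
  rw [diverg, (hasFDerivAt_integral_smul_sub hK hvc hvM hDK
    (integrable_smul_comp_sub hK.continuous hKC hv) x).fderiv]
  simp only [ContinuousLinearMap.integral_apply hI, smul_apply, diverg, Finset.mul_sum]
  rw [integral_finsetSum _ fun i _ => ?_]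
  · refine Finset.sum_congr rfl fun i _ => ?_
    rw [real_inner_comm, ← integral_inner (hi i)]
    simp only [inner_smul_right, real_inner_comm]
  · simpa only [inner_smul_right, real_inner_comm] using
      (hi i).const_inner (𝕜 := ℝ) (EuclideanSpace.single i (1 : ℝ))

lemma abs_diverg_integral_smul_comp_sub_le (hK : ContDiff ℝ 1 K) (hKC : ∀ x, ‖K x‖ ≤ C)
    (hDK : Integrable fun x => ‖fderiv ℝ K x‖) (hdK : Integrable fun x => |diverg K x|)
    (hvc : Continuous v) (hvM : ∀ x, |v x| ≤ M) (hv : Integrable v) (x : Euc d) :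
    |diverg (fun x => ∫ y, v y • K (x - y)) x| ≤ M * ∫ y, |diverg K y| := by
  rw [diverg_integral_smul_comp_sub hK hKC hDK hvc hvM hv,
    ← integral_sub_left_eq_self (fun y => |diverg K y|) volume x, ← integral_const_mul]
  refine (Real.norm_eq_abs _).symm.trans_le
    (norm_integral_le_of_norm_le ((hdK.comp_sub_left x).const_mul M) (.of_forall fun y => ?_))
  rw [norm_mul]
  exact mul_le_mul_of_nonneg_right (hvM y) (norm_nonneg _)

lemma abs_lap_le {u : Euc d → ℝ} (hu : ContDiff ℝ 2 u) (x : Euc d) :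
    |lap u x| ≤ d * ‖fderiv ℝ (fderiv ℝ u) x‖ := by
  rw [lap_eq_sum hu]
  refine (Finset.abs_sum_le_sum_abs _ _).trans ?_
  calc _ ≤ ∑ _i : Fin d, ‖fderiv ℝ (fderiv ℝ u) x‖ := by
        refine Finset.sum_le_sum fun i _ => ?_
        have h := (fderiv ℝ (fderiv ℝ u) x).le_opNorm₂ (EuclideanSpace.single i 1)
          (EuclideanSpace.single i 1)
        simpa using h
    _ = _ := by simp

end Force

section Rate

variable {d : ℕ} {δ : ℝ} {χ v g : Euc d → ℝ}

/-- The growth rate of the localised total variation of a solution. -/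
lemma neg_integral_diverg_mul_rate_le {ε A₀ A₁ A₂ C M c : ℝ} {f : ℝ → ℝ} {K : Euc d → Euc d}
    {w : Euc d → ℝ} (hδ : 0 < δ) (hε : 0 ≤ ε) (hf : ContDiff ℝ 2 f) (hK : ContDiff ℝ 1 K)
    (hKC : ∀ x, ‖K x‖ ≤ C) (hDK : Integrable fun x => ‖fderiv ℝ K x‖)
    (hdK : Integrable fun x => |diverg K x|) (hv : ContDiff ℝ 3 v) (hvM : ∀ x, |v x| ≤ M)
    (hvi : Integrable v) (hχ : ContDiff ℝ 1 χ) (hc : HasCompactSupport χ)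
    (hχ0 : ∀ x, 0 ≤ χ x) (hχ1 : ∀ x, χ x ≤ 1) (hχc : ∀ x, ‖fderiv ℝ χ x‖ ≤ c)
    (hA₀ : ∀ x, |f (v x)| ≤ A₀) (hA₁ : ∀ x, |deriv f (v x)| ≤ A₁)
    (hA₂ : ∀ x, |deriv (deriv f) (v x)| ≤ A₂) (hg : Integrable g)
    (hvg : ∀ x, ‖fderiv ℝ v x‖ ≤ g x) (hvg' : ∀ x, ‖fderiv ℝ (fderiv ℝ v) x‖ ≤ g x)
    (hw : ∀ x, w x + diverg (fun z => f (v z) • ∫ y, v y • K (z - y)) x = ε * lap v x) :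
    -∫ x, diverg (fun z => χ z • smoothDir δ (gradient v z)) x * w x ≤
      (A₀ * (∫ x, |diverg K x|) + A₁ * (M * ∫ x, ‖fderiv ℝ K x‖)) * (∫ x, ‖fderiv ℝ v x‖) +
        c * ((ε + A₁ * (C * ∫ x, |v x|)) * ∫ x, g x) +
        δ * (A₂ * (C * ∫ x, |v x|) * (∫ x, g x) +
          A₁ * (M * ∫ x, |diverg K x|) * ∫ x, χ x) := by
  have hv2 : ContDiff ℝ 2 v := hv.of_le (by norm_num)
  have hn : ContDiff ℝ 1 fun x => smoothDir δ (gradient v x) :=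
    contDiff_smoothDir_gradient hδ hv2 (by norm_num)
  have hW : ContDiff ℝ 1 fun z => χ z • smoothDir δ (gradient v z) := hχ.smul hn
  have hWc : HasCompactSupport fun z => χ z • smoothDir δ (gradient v z) := hc.smul_right
  have hF : ContDiff ℝ 1 fun x => ∫ y, v y • K (x - y) :=
    contDiff_integral_smul_comp_sub hK hKC hDK hv.continuous hvM hvi
  have hfv : ContDiff ℝ 1 fun z => f (v z) :=
    (hf.of_le (by norm_num)).comp (hv.of_le (by norm_num))
  have hfF : ContDiff ℝ 1 fun z => f (v z) • ∫ y, v y • K (z - y) := hfv.smul hF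
  have cD := continuous_diverg hfF
  have cW := continuous_diverg hW
  have cl := (contDiff_lap hv).continuous
  have hadK : Integrable (diverg K) :=
    (integrable_norm_iff (continuous_diverg hK).aestronglyMeasurable).1 hdK
  have I1 : Integrable fun x =>
      diverg (fun z => χ z • smoothDir δ (gradient v z)) x * lap v x :=
    Continuous.integrable_of_hasCompactSupport (by fun_prop) hWc.diverg.mul_right
  have I2 : Integrable fun x => diverg (fun z => χ z • smoothDir δ (gradient v z)) x *
      diverg (fun z => f (v z) • ∫ y, v y • K (z - y)) x :=
    Continuous.integrable_of_hasCompactSupport (by fun_prop) hWc.diverg.mul_right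
  have I3 : Integrable fun x =>
      ε * (diverg (fun z => χ z • smoothDir δ (gradient v z)) x * lap v x) := I1.const_mul ε
  have e : ∀ x, diverg (fun z => χ z • smoothDir δ (gradient v z)) x * w x =
      ε * (diverg (fun z => χ z • smoothDir δ (gradient v z)) x * lap v x) -
        diverg (fun z => χ z • smoothDir δ (gradient v z)) x *
          diverg (fun z => f (v z) • ∫ y, v y • K (z - y)) x := fun x => by
    rw [eq_sub_of_add_eq (hw x)]
    ring
  have h1 := mul_le_mul_of_nonneg_left
    (neg_integral_diverg_mul_lap_le hδ hv hχ hc hχ0 hχc hg hvg') hε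
  have h2 := integral_diverg_mul_transport_le hδ hf hv2 hvM hχ hc hχ0 hχ1 hχc hF
    (norm_integral_smul_comp_sub_le hKC hvi)
    (norm_fderiv_integral_smul_comp_sub_le hK hKC hDK hv.continuous hvM hvi) hadK
    (diverg_integral_smul_comp_sub hK hKC hDK hv.continuous hvM hvi)
    (abs_diverg_integral_smul_comp_sub_le hK hKC hDK hdK hv.continuous hvM hvi)
    hA₀ hA₁ hA₂ hg hvg
  simp only [e]
  rw [integral_sub I3 I2, integral_const_mul]
  linarith

end Rate

section Cutoff

open Filter Topology

variable {d : ℕ}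

lemma exists_cutoff (d : ℕ) : ∃ (χ : ℕ → Euc d → ℝ) (C : ℝ), 0 ≤ C ∧
    (∀ N, ContDiff ℝ 1 (χ N)) ∧ (∀ N, HasCompactSupport (χ N)) ∧ (∀ N x, 0 ≤ χ N x) ∧
    (∀ N x, χ N x ≤ 1) ∧ (∀ N x, ‖fderiv ℝ (χ N) x‖ ≤ C / (N + 1)) ∧
    ∀ x, ∀ᶠ N in atTop, χ N x = 1 := by
  let b : ContDiffBump (0 : Euc d) := ⟨1, 2, one_pos, one_lt_two⟩
  have hb : ContDiff ℝ 1 b := b.contDiff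
  obtain ⟨C, hC⟩ := (hb.continuous_fderiv one_ne_zero).bounded_above_of_compact_support
    (b.hasCompactSupport.fderiv ℝ)
  have hpos : ∀ N : ℕ, (0 : ℝ) < N + 1 := fun N => by positivity
  refine ⟨fun N x => b ((N + 1 : ℝ)⁻¹ • x), C, (norm_nonneg _).trans (hC 0),
    fun N => hb.comp (contDiff_const_smul _), fun N => ?_, fun N x => b.nonneg,
    fun N x => b.le_one, fun N x => ?_, fun x => ?_⟩
  · refine HasCompactSupport.intro (isCompact_closedBall 0 (2 * (N + 1 : ℝ))) fun x hx => ?_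
    refine b.zero_of_le_dist ?_
    rw [Metric.mem_closedBall, not_le, dist_zero_right] at hx
    rw [dist_zero_right, norm_smul, norm_inv, Real.norm_of_nonneg (hpos N).le,
      le_inv_mul_iff₀ (hpos N)]
    change (N + 1 : ℝ) * 2 ≤ ‖x‖
    linarith
  · have h : HasFDerivAt (fun x => b ((N + 1 : ℝ)⁻¹ • x)) _ x :=
      (hb.differentiable one_ne_zero _).hasFDerivAt.comp x
        ((hasFDerivAt_id x).const_smul (N + 1 : ℝ)⁻¹)
    rw [h.fderiv, ContinuousLinearMap.comp_smul, norm_smul, norm_inv,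
      Real.norm_of_nonneg (hpos N).le, div_eq_inv_mul]
    exact mul_le_mul_of_nonneg_left (by simpa using hC _) (inv_nonneg.2 (hpos N).le)
  · obtain ⟨N₀, hN₀⟩ := exists_nat_ge ‖x‖
    filter_upwards [eventually_ge_atTop N₀] with N hN
    refine b.one_of_mem_closedBall ?_
    rw [mem_closedBall_zero_iff, norm_smul, norm_inv, Real.norm_of_nonneg (hpos N).le,
      inv_mul_le_iff₀ (hpos N)]
    change ‖x‖ ≤ (N + 1 : ℝ) * 1
    have : (N₀ : ℝ) ≤ N := Nat.cast_le.2 hN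
    linarith

lemma norm_mul_smoothNorm_le {r δ : ℝ} (hδ : 0 < δ) (h0 : 0 ≤ r) (h1 : r ≤ 1) (p : Euc d) :
    ‖r * smoothNorm δ p‖ ≤ ‖p‖ := by
  rw [Real.norm_of_nonneg (mul_nonneg h0 (smoothNorm_nonneg p))]
  exact (mul_le_of_le_one_left (smoothNorm_nonneg p) h1).trans (smoothNorm_le_norm hδ p)

lemma tendsto_integral_mul_smoothNorm {χ : ℕ → Euc d → ℝ} {δ : ℕ → ℝ} {P : Euc d → Euc d}
    (hδ : ∀ N, 0 < δ N) (hδ0 : Tendsto δ atTop (𝓝 0)) (hχ : ∀ N, Continuous (χ N))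
    (hχ0 : ∀ N x, 0 ≤ χ N x) (hχ1 : ∀ N x, χ N x ≤ 1) (hχl : ∀ x, ∀ᶠ N in atTop, χ N x = 1)
    (hP : Continuous P) (hPi : Integrable fun x => ‖P x‖) :
    Tendsto (fun N => ∫ x, χ N x * smoothNorm (δ N) (P x)) atTop (𝓝 (∫ x, ‖P x‖)) := by
  refine tendsto_integral_of_dominated_convergence _ (fun N => ?_) hPi
    (fun N => .of_forall fun x => norm_mul_smoothNorm_le (hδ N) (hχ0 N x) (hχ1 N x) _)
    (.of_forall fun x => ?_)
  · exact ((hχ N).mul ((contDiff_smoothNorm (n := 0) (hδ N)).continuous.comp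
      hP)).aestronglyMeasurable
  · have hl : Tendsto (fun N => ‖P x‖ - δ N) atTop (𝓝 ‖P x‖) := by
      simpa using tendsto_const_nhds.sub hδ0
    refine tendsto_of_tendsto_of_tendsto_of_le_of_le' hl tendsto_const_nhds ?_ ?_ <;>
      filter_upwards [hχl x] with N hN
    · rw [hN, one_mul]
      exact norm_sub_le_smoothNorm _
    · rw [hN, one_mul]
      exact smoothNorm_le_norm (hδ N) _

lemma continuousOn_integral_mul_smoothNorm_gradient {χ g : Euc d → ℝ} {δ : ℝ}
    {u : ℝ → Euc d → ℝ} {I : Set ℝ} (hδ : 0 < δ) (hχ : Continuous χ) (hχ0 : ∀ x, 0 ≤ χ x)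
    (hχ1 : ∀ x, χ x ≤ 1) (hg : Integrable g)
    (hc : ContinuousOn (fun p : ℝ × Euc d => fderiv ℝ (u p.1) p.2) (I ×ˢ Set.univ))
    (hug : ∀ t ∈ I, ∀ x, ‖fderiv ℝ (u t) x‖ ≤ g x) :
    ContinuousOn (fun s => ∫ x, χ x * smoothNorm δ (gradient (u s) x)) I := by
  have hJ : Continuous (InnerProductSpace.toDual ℝ (Euc d)).symm :=
    (InnerProductSpace.toDual ℝ (Euc d)).symm.continuous
  have cN : Continuous (smoothNorm δ : Euc d → ℝ) := (contDiff_smoothNorm (n := 0) hδ).continuous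
  refine continuousOn_of_dominated (bound := g) (fun s hs => ?_)
    (fun s hs => .of_forall fun x => ?_) hg (.of_forall fun x => ?_)
  · exact (hχ.mul (cN.comp (hJ.comp (hc.comp_continuous (Continuous.prodMk_right s)
      fun x => ⟨hs, Set.mem_univ _⟩)))).aestronglyMeasurable
  · exact (norm_mul_smoothNorm_le hδ (hχ0 x) (hχ1 x) _).trans
      ((norm_gradient (u s) x).trans_le (hug s hs x))
  · exact continuousOn_const.mul (cN.comp_continuousOn (hJ.comp_continuousOn
      (hc.comp (Continuous.prodMk_left x).continuousOn fun s hs => ⟨hs, Set.mem_univ _⟩)))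

end Cutoff

section Coefficient

open Set

variable {h : ℝ → ℝ}

lemma bddAbove_abs_image_Icc (hh : Continuous h) (a b : ℝ) :
    BddAbove ((fun ξ => |h ξ|) '' Icc a b) :=
  (isCompact_Icc.image hh.abs).bddAbove

lemma sSup_abs_image_nonneg (s : Set ℝ) : 0 ≤ sSup ((fun ξ => |h ξ|) '' s) :=
  Real.sSup_nonneg (by rintro _ ⟨ξ, -, rfl⟩; exact abs_nonneg _)

lemma abs_le_sSup_abs_image (hh : Continuous h) {ξ r : ℝ} (hξ : |ξ| ≤ r) :
    |h ξ| ≤ sSup ((fun ξ => |h ξ|) '' Icc (-r) r) :=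
  le_csSup (bddAbove_abs_image_Icc hh _ _) ⟨ξ, abs_le.1 hξ, rfl⟩

lemma monotone_sSup_abs_image (hh : Continuous h) :
    Monotone fun r => sSup ((fun ξ => |h ξ|) '' Icc (-r) r) := by
  intro r s hrs
  rcases lt_or_ge r 0 with hr | hr
  · have hr' : Icc (-r) r = ∅ := Icc_eq_empty (by linarith)
    simpa [hr'] using sSup_abs_image_nonneg (h := h) (Icc (-s) s)
  · exact csSup_le_csSup (bddAbove_abs_image_Icc hh _ _)
      ((nonempty_Icc.2 (by linarith)).image _) (image_mono (Icc_subset_Icc (by linarith) hrs))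

lemma exists_measurable_eqOn_iSup_abs {X : Type*} [TopologicalSpace X] {u : ℝ → X → ℝ}
    {T M : ℝ} (hT : 0 ≤ T) (hu : ∀ x, ContinuousOn (fun s => u s x) (Icc 0 T))
    (huM : ∀ s ∈ Icc 0 T, ∀ x, |u s x| ≤ M) :
    ∃ m : ℝ → ℝ, Measurable m ∧ ∀ s ∈ Icc 0 T, m s = ⨆ x, |u s x| := by
  refine ⟨fun s => ⨆ x, |u (projIcc 0 T hT s) x|, ?_, fun s hs => by
    simp only [projIcc_of_mem hT hs]⟩
  refine (lowerSemicontinuous_ciSup (fun s => ⟨M, ?_⟩) fun x => ?_).measurable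
  · rintro _ ⟨x, rfl⟩
    exact huM _ (projIcc 0 T hT s).2 x
  · exact (((hu x).domRestrict.comp continuous_projIcc).abs).lowerSemicontinuous

end Coefficient

theorem stmt_14 (d : ℕ) (hd : 1 ≤ d) (ε : ℝ) (hε : 0 ≤ ε) (T : ℝ) (hT : 0 < T)
    (f : ℝ → ℝ) (hf : ContDiff ℝ 2 f)
    (K : Euc d → Euc d) (hK : ContDiff ℝ 1 K) (MK : ℝ) (hKb : ∀ x, ‖K x‖ ≤ MK)
    (hDK : Integrable (fun x => ‖fderiv ℝ K x‖))
    (hdivK : Integrable (fun x => |diverg K x|))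
    (u ut : ℝ → Euc d → ℝ) (Mu : ℝ)
    (huc : ContinuousOn (fun p : ℝ × Euc d => u p.1 p.2) (Set.Icc 0 T ×ˢ Set.univ))
    (hub : ∀ t ∈ Set.Icc (0:ℝ) T, ∀ x, |u t x| ≤ Mu)
    (hut : ∀ t ∈ Set.Ioo (0:ℝ) T, ∀ x, HasDerivAt (fun τ => u τ x) (ut t x) t)
    (hux : ∀ t ∈ Set.Icc (0:ℝ) T, ContDiff ℝ 3 (u t))
    (hui : ∀ t ∈ Set.Icc (0:ℝ) T, Integrable (u t))
    (g : Euc d → ℝ) (hg : Integrable g)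
    (hdom : ∀ t ∈ Set.Icc (0:ℝ) T, ∀ x, ∀ n ≤ 3, ‖iteratedFDeriv ℝ n (u t) x‖ ≤ g x)
    (hderc : ∀ n ≤ 3, ContinuousOn
      (fun p : ℝ × Euc d => iteratedFDeriv ℝ n (u p.1) p.2) (Set.Icc 0 T ×ˢ Set.univ))
    (hPDE : ∀ t ∈ Set.Ioo (0:ℝ) T, ∀ x,
      ut t x + diverg (fun z => f (u t z) • ∫ y, u t y • K (z - y)) x
        = ε * lap (u t) x) :
    ∀ t ∈ Set.Icc (0:ℝ) T,
      ∫ x, ‖gradient (u t) x‖ ≤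
        Real.exp (∫ s in (0:ℝ)..t,
            (sSup ((fun ξ => |f ξ|) '' Set.Icc (-(⨆ x, |u s x|)) (⨆ x, |u s x|)) *
                (∫ x, |diverg K x|)
              + sSup ((fun ξ => |deriv f ξ|) '' Set.Icc (-(⨆ x, |u s x|)) (⨆ x, |u s x|)) *
                (∫ x, ‖fderiv ℝ K x‖) * (⨆ x, |u s x|)))
          * ∫ x, ‖gradient (u 0) x‖ := by
  intro t ht
  have hI : ∀ s ∈ Set.Icc 0 t, s ∈ Set.Icc 0 T := fun s hs => ⟨hs.1, hs.2.trans ht.2⟩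
  have hIoo : ∀ s ∈ Set.Ioo 0 t, s ∈ Set.Ioo 0 T := fun s hs => ⟨hs.1, hs.2.trans_le ht.2⟩
  have h0T : (0 : ℝ) ∈ Set.Icc 0 T := ⟨le_rfl, hT.le⟩
  have hMK : 0 ≤ MK := (norm_nonneg _).trans (hKb 0)
  have hMu : 0 ≤ Mu := (abs_nonneg _).trans (hub 0 h0T 0)
  -- derivatives of the solution
  have c1 : ContinuousOn (fun p : ℝ × Euc d => fderiv ℝ (u p.1) p.2) (Set.Icc 0 T ×ˢ Set.univ) :=
    continuousOn_of_iteratedFDeriv_zero (u := fun s => fderiv ℝ (u s))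
      (continuousOn_iteratedFDeriv_fderiv (hderc 1 (by norm_num)))
  have c2 : ContinuousOn (fun p : ℝ × Euc d => fderiv ℝ (fderiv ℝ (u p.1)) p.2)
      (Set.Icc 0 T ×ˢ Set.univ) :=
    continuousOn_of_iteratedFDeriv_zero (u := fun s => fderiv ℝ (fderiv ℝ (u s)))
      (continuousOn_iteratedFDeriv_fderiv (u := fun s => fderiv ℝ (u s))
        (continuousOn_iteratedFDeriv_fderiv (hderc 2 (by norm_num))))
  have g0 : ∀ s ∈ Set.Icc 0 T, ∀ x, |u s x| ≤ g x := fun s hs x => by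
    simpa using hdom s hs x 0 (by norm_num)
  have g1 : ∀ s ∈ Set.Icc 0 T, ∀ x, ‖fderiv ℝ (u s) x‖ ≤ g x := fun s hs x => by
    simpa [norm_iteratedFDeriv_one] using hdom s hs x 1 (by norm_num)
  have g2 : ∀ s ∈ Set.Icc 0 T, ∀ x, ‖fderiv ℝ (fderiv ℝ (u s)) x‖ ≤ g x := fun s hs x => by
    have := hdom s hs x 2 (by norm_num)
    rwa [← norm_iteratedFDeriv_fderiv, norm_iteratedFDeriv_one] at this
  have hu2 : ∀ s ∈ Set.Icc 0 T, ContDiff ℝ 2 (u s) := fun s hs => (hux s hs).of_le (by norm_num)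
  set G := ∫ x, g x
  have hG0 : 0 ≤ G := integral_nonneg fun x => (abs_nonneg _).trans (g0 0 h0T x)
  have hv1 : ∀ s ∈ Set.Icc 0 T, ∫ x, |u s x| ≤ G := fun s hs =>
    integral_mono (hui s hs).abs hg (g0 s hs)
  have gi : ∀ s ∈ Set.Icc 0 T, Integrable fun x => ‖gradient (u s) x‖ := fun s hs =>
    hg.mono' ((contDiff_gradient (m := 0) (hu2 s hs) (by norm_num)).continuous.norm
      |>.aestronglyMeasurable) (.of_forall fun x => by
        rw [norm_norm, norm_gradient]
        exact g1 s hs x)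
  -- bounds on the mobility
  have cf := hf.continuous
  have hf1 : ContDiff ℝ 1 (deriv f) := by
    have : ContDiff ℝ (1 + 1) f := by simpa [one_add_one_eq_two] using hf
    exact (contDiff_succ_iff_deriv.1 this).2.2
  have cf1 := hf1.continuous
  have cf2 : Continuous (deriv (deriv f)) := hf1.continuous_deriv le_rfl
  set S : (ℝ → ℝ) → ℝ → ℝ := fun h r => sSup ((fun ξ => |h ξ|) '' Set.Icc (-r) r)
  have hbdd : ∀ s ∈ Set.Icc 0 T, BddAbove (Set.range fun x => |u s x|) := fun s hs =>
    ⟨Mu, by rintro _ ⟨x, rfl⟩; exact hub s hs x⟩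
  set m : ℝ → ℝ := fun s => ⨆ x, |u s x|
  have hum : ∀ s ∈ Set.Icc 0 T, ∀ x, |u s x| ≤ m s := fun s hs x => le_ciSup (hbdd s hs) x
  have hm0 : ∀ s, 0 ≤ m s := fun s => Real.iSup_nonneg fun x => abs_nonneg _
  have hmM : ∀ s ∈ Set.Icc 0 T, m s ≤ Mu := fun s hs => ciSup_le (hub s hs)
  have hS0 : ∀ h r, 0 ≤ S h r := fun h r => sSup_abs_image_nonneg _
  have hSf := monotone_sSup_abs_image cf
  have hSf1 := monotone_sSup_abs_image cf1
  set α := ∫ x, |diverg K x|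
  set β := ∫ x, ‖fderiv ℝ K x‖
  have hα0 : 0 ≤ α := integral_nonneg fun x => abs_nonneg _
  have hβ0 : 0 ≤ β := integral_nonneg fun x => norm_nonneg _
  set a : ℝ → ℝ := fun s => S f (m s) * α + S (deriv f) (m s) * β * m s with ha
  have ha0 : ∀ s, 0 ≤ a s := fun s =>
    add_nonneg (mul_nonneg (hS0 _ _) hα0) (mul_nonneg (mul_nonneg (hS0 _ _) hβ0) (hm0 s))
  have haI : IntegrableOn a (Set.Icc 0 t) := by
    obtain ⟨m', hm', hmm'⟩ := exists_measurable_eqOn_iSup_abs (u := u) hT.le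
      (fun x => huc.comp (Continuous.prodMk_left x).continuousOn
        fun s hs => ⟨hs, Set.mem_univ _⟩) hub
    have meas : Measurable fun s => S f (m' s) * α + S (deriv f) (m' s) * β * m' s :=
      ((hSf.measurable.comp hm').mul_const α).add
        (((hSf1.measurable.comp hm').mul_const β).mul hm')
    have heq : Set.EqOn (fun s => S f (m' s) * α + S (deriv f) (m' s) * β * m' s) a
        (Set.Icc 0 t) := fun s hs => by
      have : m' s = m s := hmm' s (hI s hs)
      simp only [ha, this]
    refine IntegrableOn.congr_fun (Measure.integrableOn_of_bounded
      (M := S f Mu * α + S (deriv f) Mu * β * Mu) (by simp) meas.aestronglyMeasurable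
      ((ae_restrict_iff' measurableSet_Icc).2 (.of_forall fun s hs => ?_))) heq measurableSet_Icc
    have has : S f (m' s) * α + S (deriv f) (m' s) * β * m' s = a s := heq hs
    rw [has, Real.norm_of_nonneg (ha0 s)]
    have := hmM s (hI s hs)
    have := hSf this
    have := hSf1 (hmM s (hI s hs))
    have := hm0 s
    have := hS0 (deriv f) Mu
    simp only [ha]
    gcongr
  -- cutoffs
  obtain ⟨χ, C, hC0, hχ, hχs, hχ0, hχ1, hχc, hχl⟩ := exists_cutoff d
  have hX0 : ∀ N, 0 ≤ ∫ x, χ N x := fun N => integral_nonneg (hχ0 N)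
  set δ : ℕ → ℝ := fun N => 1 / ((N + 1) * (1 + ∫ x, χ N x)) with hδ_def
  have hN0 : ∀ N : ℕ, (0 : ℝ) < N + 1 := fun N => by positivity
  have hδ : ∀ N, 0 < δ N := fun N =>
    one_div_pos.2 (mul_pos (hN0 N) (by linarith [hX0 N]))
  have hδle : ∀ N, δ N ≤ 1 / (N + 1) := fun N =>
    one_div_le_one_div_of_le (hN0 N) (le_mul_of_one_le_right (hN0 N).le (by linarith [hX0 N]))
  have hδX : ∀ N, δ N * ∫ x, χ N x ≤ 1 / (N + 1) := fun N => by
    have : 0 < 1 + ∫ x, χ N x := by linarith [hX0 N]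
    have hN := hN0 N
    rw [hδ_def, div_mul_eq_mul_div, one_mul, div_le_div_iff₀ (by positivity) hN]
    nlinarith
  have hδ0 : Filter.Tendsto δ Filter.atTop (nhds 0) :=
    squeeze_zero (fun N => (hδ N).le) hδle tendsto_one_div_add_atTop_nhds_zero_nat
  set L₁ := S (deriv f) Mu
  set L₂ := S (deriv (deriv f)) Mu
  have hL₁ : 0 ≤ L₁ := hS0 _ _
  have hL₂ : 0 ≤ L₂ := hS0 _ _
  set E := C * ((ε + L₁ * (MK * G)) * G) + (L₂ * (MK * G) * G + L₁ * (Mu * α)) with hE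
  have key := le_exp_integral_mul_of_tendsto (t := t)
    (ψ := fun N s => ∫ x, χ N x * smoothNorm (δ N) (gradient (u s) x))
    (ψ' := fun N s =>
      -∫ x, diverg (fun z => χ N z • smoothDir (δ N) (gradient (u s) z)) x * ut s x)
    (a := a) (Φ := fun s => ∫ x, ‖gradient (u s) x‖) (e := fun N => E * (1 / (N + 1)))
    (B := G) ht.1
    (fun N => (continuousOn_integral_mul_smoothNorm_gradient (hδ N) (hχ N).continuous (hχ0 N)
      (hχ1 N) hg c1 g1).mono hI)
    (fun N s _ => integral_nonneg fun x => mul_nonneg (hχ0 N x) (smoothNorm_nonneg _))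
    ?_ ?_ (by simpa using tendsto_one_div_add_atTop_nhds_zero_nat.const_mul E)
    (fun s hs => tendsto_integral_mul_smoothNorm hδ hδ0 (fun N => (hχ N).continuous) hχ0 hχ1 hχl
      (contDiff_gradient (m := 0) (hu2 s (hI s hs)) (by norm_num)).continuous (gi s (hI s hs)))
    (fun s _ => ha0 s) haI
    (fun s hs => integral_mono (gi s (hI s hs)) hg fun x =>
      (norm_gradient (u s) x).trans_le (g1 s (hI s hs) x))
  · exact key
  · intro N s hs
    have hc : IsCompact (Set.Icc 0 T ×ˢ tsupport (χ N)) :=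
      isCompact_Icc.prod (HasCompactSupport.isCompact (hχs N))
    obtain ⟨G₁, hG₁⟩ := hc.exists_bound_of_continuousOn
      (c1.mono (Set.prod_mono_right (Set.subset_univ _)))
    obtain ⟨G₂, hG₂⟩ := hc.exists_bound_of_continuousOn
      (f := fun p : ℝ × Euc d => fderiv ℝ (fderiv ℝ (u p.1)) p.2) (c2.mono (Set.prod_mono_right (Set.subset_univ _)))
    refine hasDerivWithinAt_integral_smoothNorm_gradient (L := ε * (d * G₂) +
      (S f Mu * (Mu * α) + L₁ * (G₁ * (MK * G)))) (hδ N) (hχ N) (hχs N) (hχ0 N) hu2 c1 c2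
      hut (fun r hr x hx => ?_) (hIoo s hs)
    have hr' := Set.Ioo_subset_Icc_self hr
    have e := eq_sub_of_add_eq (hPDE r hr x)
    rw [diverg_comp_smul hf (hu2 r hr') (contDiff_integral_smul_comp_sub hK hKb hDK
      (hux r hr').continuous (hub r hr') (hui r hr'))] at e
    rw [e]
    have b1 := (abs_lap_le (hu2 r hr') x).trans
      (mul_le_mul_of_nonneg_left (hG₂ (r, x) ⟨hr', hx⟩) (Nat.cast_nonneg d))
    have b2 := abs_diverg_integral_smul_comp_sub_le hK hKb hDK hdivK
      (hux r hr').continuous (hub r hr') (hui r hr') x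
    have b3 := (norm_integral_smul_comp_sub_le hKb (hui r hr') x).trans
      (mul_le_mul_of_nonneg_left (hv1 r hr') hMK)
    have b4 := abs_le_sSup_abs_image cf (hub r hr' x)
    have b5 := abs_le_sSup_abs_image cf1 (hub r hr' x)
    have b6 := ((fderiv ℝ (u r) x).le_opNorm _).trans (mul_le_mul (hG₁ (r, x) ⟨hr', hx⟩) b3
      (norm_nonneg _) ((norm_nonneg _).trans (hG₁ (r, x) ⟨hr', hx⟩)))
    refine (abs_sub _ _).trans (add_le_add ?_ ((abs_add_le _ _).trans (add_le_add ?_ ?_)))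
    · rw [abs_mul, abs_of_nonneg hε]
      exact mul_le_mul_of_nonneg_left b1 hε
    · rw [abs_mul]
      exact mul_le_mul b4 b2 (abs_nonneg _) (hS0 _ _)
    · rw [abs_mul]
      exact mul_le_mul b5 b6 (abs_nonneg _) (hS0 _ _)
  · intro N s hs
    have hs' := hI s (Set.Ioo_subset_Icc_self hs)
    have hA₁ : S (deriv f) (m s) ≤ L₁ := hSf1 (hmM s hs')
    have h := neg_integral_diverg_mul_rate_le (hδ N) hε hf hK hKb hDK hdivK (hux s hs')
      (hum s hs') (hui s hs') (hχ N) (hχs N) (hχ0 N) (hχ1 N) (hχc N)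
      (fun x => abs_le_sSup_abs_image cf (hum s hs' x))
      (fun x => abs_le_sSup_abs_image cf1 (hum s hs' x))
      (fun x => abs_le_sSup_abs_image cf2 (hub s hs' x)) hg (g1 s hs') (g2 s hs')
      (hPDE s (hIoo s hs))
    refine h.trans ?_
    simp only [← norm_gradient]
    have hms := hmM s hs'
    have hm0s := hm0 s
    have hvs := hv1 s hs'
    have e1 : C / (N + 1) * ((ε + S (deriv f) (m s) * (MK * ∫ x, |u s x|)) * G) ≤
        C / (N + 1) * ((ε + L₁ * (MK * G)) * G) := by
      have := hN0 N
      gcongr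
    have e2 : δ N * (L₂ * (MK * ∫ x, |u s x|) * G) ≤ 1 / (N + 1) * (L₂ * (MK * G) * G) := by
      have := hδle N
      have := (hδ N).le
      gcongr
    have e3 : S (deriv f) (m s) * (m s * α) * (δ N * ∫ x, χ N x) ≤
        L₁ * (Mu * α) * (1 / (N + 1)) := by
      have := hδX N
      have := mul_nonneg (hδ N).le (hX0 N)
      gcongr
    have e4 : E * (1 / ((N : ℝ) + 1)) = C / (N + 1) * ((ε + L₁ * (MK * G)) * G) +
        (1 / (N + 1) * (L₂ * (MK * G) * G) + L₁ * (Mu * α) * (1 / (N + 1))) := by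
      rw [hE]
      ring
    rw [e4]
    simp only [ha]
    linarith
end
end

section
/- (L¹–interpolation between W^{−1,1} and W^{1,1}.) Let d ≥ 1. There exists a constant C > 0 depending only on d such that for every continuously differentiable integrable function w : ℝ^d → ℝ with ∫_{ℝ^d}‖∇w‖ < ∞, one has ∫_{ℝ^d}|w| ≤ C·√( A·( ∫_{ℝ^d}|w| + ∫_{ℝ^d}‖∇w‖ ) ), where A := sup{ ∫_{ℝ^d} φ(x)·w(x) dx : φ : ℝ^d → ℝ continuously differentiable with compact support, sup|φ| ≤ 1 and sup‖∇φ‖ ≤ 1 }. -/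
open MeasureTheory Real
open scoped RealInnerProductSpace

noncomputable section

section Interpolation

variable {E : Type*} [NormedAddCommGroup E] [NormedSpace ℝ E] [FiniteDimensional ℝ E]
  [MeasurableSpace E] [BorelSpace E] {μ : Measure E} [μ.IsAddHaarMeasure]

omit [FiniteDimensional ℝ E] [MeasurableSpace E] [BorelSpace E] in
theorem enorm_add_sub_le_lintegral_fderiv {w : E → ℝ} (hw : ContDiff ℝ 1 w) (x h : E) :
    ‖w (x + h) - w x‖ₑ ≤ ∫⁻ τ in Set.Ioc (0 : ℝ) 1, ‖fderiv ℝ w (x + τ • h)‖ₑ * ‖h‖ₑ := by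
  have hc : Continuous fun τ : ℝ => fderiv ℝ w (x + τ • h) h :=
    ((hw.continuous_fderiv one_ne_zero).comp (by fun_prop)).clm_apply continuous_const
  have hd : ∀ τ : ℝ, HasDerivAt (fun τ : ℝ => w (x + τ • h)) (fderiv ℝ w (x + τ • h) h) τ := by
    intro τ
    have h1 : HasDerivAt (fun τ : ℝ => x + τ • h) h τ := by
      simpa using ((hasDerivAt_id τ).smul_const h).const_add x
    exact ((hw.differentiable one_ne_zero) (x + τ • h)).hasFDerivAt.comp_hasDerivAt τ h1
  have hftc := intervalIntegral.integral_eq_sub_of_hasDerivAt (a := 0) (b := 1)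
    (fun τ _ => hd τ) (hc.intervalIntegrable 0 1)
  rw [intervalIntegral.integral_of_le zero_le_one] at hftc
  simp only [one_smul, zero_smul, add_zero] at hftc
  rw [← hftc]
  exact (enorm_integral_le_lintegral_enorm _).trans
    (lintegral_mono fun τ => (fderiv ℝ w (x + τ • h)).le_opENorm h)

theorem lintegral_enorm_add_sub_le {w : E → ℝ} (hw : ContDiff ℝ 1 w) (h : E) :
    ∫⁻ x, ‖w (x + h) - w x‖ₑ ∂μ ≤ (∫⁻ x, ‖fderiv ℝ w x‖ₑ ∂μ) * ‖h‖ₑ := by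
  have hc : Continuous fun p : E × ℝ => fderiv ℝ w (p.1 + p.2 • h) :=
    (hw.continuous_fderiv one_ne_zero).comp (by fun_prop)
  calc ∫⁻ x, ‖w (x + h) - w x‖ₑ ∂μ
      ≤ ∫⁻ x, (∫⁻ τ in Set.Ioc (0 : ℝ) 1, ‖fderiv ℝ w (x + τ • h)‖ₑ * ‖h‖ₑ) ∂μ :=
        lintegral_mono fun x => enorm_add_sub_le_lintegral_fderiv hw x h
    _ = ∫⁻ τ in Set.Ioc (0 : ℝ) 1, (∫⁻ x, ‖fderiv ℝ w (x + τ • h)‖ₑ * ‖h‖ₑ ∂μ) :=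
        lintegral_lintegral_swap (hc.enorm.measurable.mul_const _).aemeasurable
    _ = ∫⁻ _ in Set.Ioc (0 : ℝ) 1, (∫⁻ x, ‖fderiv ℝ w x‖ₑ ∂μ) * ‖h‖ₑ := by
        congr 1
        ext τ
        rw [lintegral_mul_const' _ _ enorm_ne_top,
          lintegral_add_right_eq_self (μ := μ) (fun x => ‖fderiv ℝ w x‖ₑ)]
    _ = (∫⁻ x, ‖fderiv ℝ w x‖ₑ ∂μ) * ‖h‖ₑ := by simp

theorem integral_norm_add_sub_le {w : E → ℝ} (hw : ContDiff ℝ 1 w)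
    (hg : Integrable (fderiv ℝ w) μ) (h : E) :
    ∫ x, ‖w (x + h) - w x‖ ∂μ ≤ (∫ x, ‖fderiv ℝ w x‖ ∂μ) * ‖h‖ := by
  have hm : AEStronglyMeasurable (fun x => w (x + h) - w x) μ :=
    ((hw.continuous.comp (continuous_add_const h)).sub hw.continuous).aestronglyMeasurable
  rw [integral_norm_eq_lintegral_enorm hm, integral_norm_eq_lintegral_enorm hg.1, ← toReal_enorm h,
    ← ENNReal.toReal_mul]
  exact ENNReal.toReal_mono (ENNReal.mul_ne_top hg.2.ne enorm_ne_top)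
    (lintegral_enorm_add_sub_le hw h)

/-- A rescaled mollification, at scale `ε`, of the bounded function `s` by the kernel `ρ`. -/
def mollify (μ : Measure E) (ρ s : E → ℝ) (ε : ℝ) (x : E) : ℝ :=
  convolution ρ (fun y => s (ε • y)) (ContinuousLinearMap.lsmul ℝ ℝ) μ (ε⁻¹ • x)

omit [FiniteDimensional ℝ E] [BorelSpace E] [μ.IsAddHaarMeasure] in
theorem mollify_eq_integral {ρ s : E → ℝ} {ε : ℝ} (hε : ε ≠ 0) (x : E) :
    mollify μ ρ s ε x = ∫ t, ρ t * s (x - ε • t) ∂μ := by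
  simp [mollify, convolution, smul_sub, smul_smul, hε]

omit [BorelSpace E] in
theorem locallyIntegrable_of_abs_le_one {s : E → ℝ} (hs : Measurable s) (hs1 : ∀ x, |s x| ≤ 1) :
    LocallyIntegrable s μ :=
  (locallyIntegrable_const (1 : ℝ)).mono hs.aestronglyMeasurable
    (Filter.Eventually.of_forall fun x => by simpa using hs1 x)

section Kernel

variable {ρ s : E → ℝ} {ε : ℝ}

theorem contDiff_mollify (hρ : ContDiff ℝ 1 ρ) (hρc : HasCompactSupport ρ) (hs : Measurable s)
    (hs1 : ∀ x, |s x| ≤ 1) : ContDiff ℝ 1 (mollify μ ρ s ε) := by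
  have h := hρc.contDiff_convolution_left (n := 1) (μ := μ) (ContinuousLinearMap.lsmul ℝ ℝ) hρ
    (locallyIntegrable_of_abs_le_one (hs.comp (measurable_const_smul ε)) fun x => hs1 _)
  exact h.comp (contDiff_const_smul ε⁻¹)

omit [FiniteDimensional ℝ E] [BorelSpace E] [μ.IsAddHaarMeasure] in
theorem hasCompactSupport_mollify (hρc : HasCompactSupport ρ) (hsc : HasCompactSupport s)
    (hε : ε ≠ 0) : HasCompactSupport (mollify μ ρ s ε) :=
  (hρc.convolution (μ := μ) (ContinuousLinearMap.lsmul ℝ ℝ) (hsc.comp_smul hε)).comp_smul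
    (inv_ne_zero hε)

omit [FiniteDimensional ℝ E] [BorelSpace E] [μ.IsAddHaarMeasure] in
theorem abs_mollify_le (hρ0 : ∀ x, 0 ≤ ρ x) (hρi : Integrable ρ μ) (hρ1 : ∫ x, ρ x ∂μ = 1)
    (hs1 : ∀ x, |s x| ≤ 1) (hε : ε ≠ 0) (x : E) : |mollify μ ρ s ε x| ≤ 1 := by
  rw [mollify_eq_integral hε, ← hρ1]
  rw [← Real.norm_eq_abs]
  refine norm_integral_le_of_norm_le hρi (Filter.Eventually.of_forall fun t => ?_)
  rw [norm_mul, Real.norm_of_nonneg (hρ0 t)]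
  exact mul_le_of_le_one_right (hρ0 t) (hs1 _)

theorem norm_fderiv_mollify_le (hρ : ContDiff ℝ 1 ρ) (hρc : HasCompactSupport ρ)
    (hs : Measurable s) (hs1 : ∀ x, |s x| ≤ 1) (hε : 0 < ε) (x : E) :
    ‖fderiv ℝ (mollify μ ρ s ε) x‖ ≤ (∫ t, ‖fderiv ℝ ρ t‖ ∂μ) / ε := by
  have h := hρc.hasFDerivAt_convolution_left (μ := μ) (ContinuousLinearMap.lsmul ℝ ℝ) hρ
    (locallyIntegrable_of_abs_le_one (hs.comp (measurable_const_smul ε)) fun x => hs1 _) (ε⁻¹ • x)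
  have h2 := h.comp x ((hasFDerivAt_id x).const_smul ε⁻¹)
  have h3 : HasFDerivAt (mollify μ ρ s ε) _ x := h2
  rw [h3.fderiv]
  refine (ContinuousLinearMap.opNorm_comp_le _ _).trans ?_
  rw [div_eq_mul_inv]
  have hi : Integrable (fun t => ‖fderiv ℝ ρ t‖) μ :=
    ((hρ.continuous_fderiv one_ne_zero).integrable_of_hasCompactSupport (hρc.fderiv ℝ)).norm
  gcongr
  · refine norm_integral_le_of_norm_le hi (Filter.Eventually.of_forall fun t => ?_)
    refine ContinuousLinearMap.opNorm_le_bound _ (norm_nonneg _) fun v => ?_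
    simp only [ContinuousLinearMap.precompL_apply, ContinuousLinearMap.lsmul_apply, smul_eq_mul,
      norm_mul]
    exact (mul_le_of_le_one_right (norm_nonneg _) (hs1 _)).trans (ContinuousLinearMap.le_opNorm _ _)
  · rw [norm_smul, Real.norm_of_nonneg (inv_nonneg.2 hε.le)]
    exact mul_le_of_le_one_right (inv_nonneg.2 hε.le) ContinuousLinearMap.norm_id_le

theorem integral_mul_le_integral_mollify_mul_add {w : E → ℝ}
    (hρ0 : ∀ x, 0 ≤ ρ x) (hρi : Integrable ρ μ) (hρ1 : ∫ x, ρ x ∂μ = 1)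
    (hρb : ∀ x, ρ x ≠ 0 → ‖x‖ ≤ 1) (hs : Measurable s) (hs1 : ∀ x, |s x| ≤ 1) (hε : 0 < ε)
    (hw : ContDiff ℝ 1 w) (hwi : Integrable w μ) (hg : Integrable (fderiv ℝ w) μ) :
    ∫ x, s x * w x ∂μ ≤ ∫ x, mollify μ ρ s ε x * w x ∂μ + ε * ∫ x, ‖fderiv ℝ w x‖ ∂μ := by
  set G := ∫ x, ‖fderiv ℝ w x‖ ∂μ
  set I := ∫ x, s x * w x ∂μ with hI
  have hG0 : 0 ≤ G := integral_nonneg fun _ => norm_nonneg _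
  have hprod : Integrable (Function.uncurry fun x t => s (x - ε • t) * (w x * ρ t)) (μ.prod μ) := by
    refine (hwi.mul_prod hρi).bdd_mul (c := 1) ?_ (Filter.Eventually.of_forall fun p => hs1 _)
    exact (hs.comp (by fun_prop : Measurable fun p : E × E => p.1 - ε • p.2)).aestronglyMeasurable
  have hswap : ∫ x, mollify μ ρ s ε x * w x ∂μ
      = ∫ t, ρ t * ∫ x, s x * w (x + ε • t) ∂μ ∂μ := by
    calc ∫ x, mollify μ ρ s ε x * w x ∂μ
        = ∫ x, ∫ t, s (x - ε • t) * (w x * ρ t) ∂μ ∂μ := by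
          congr 1
          ext x
          rw [mollify_eq_integral hε.ne', ← integral_mul_const]
          congr 1
          ext t
          ring
      _ = ∫ t, ∫ x, s (x - ε • t) * (w x * ρ t) ∂μ ∂μ := integral_integral_swap hprod
      _ = ∫ t, ρ t * ∫ x, s x * w (x + ε • t) ∂μ ∂μ := by
          congr 1
          ext t
          rw [← integral_const_mul, ← integral_add_right_eq_self _ (ε • t)]
          congr 1
          ext x
          rw [add_sub_cancel_right]
          ring
  have hJi : Integrable (fun t => ρ t * ∫ x, s x * w (x + ε • t) ∂μ) μ := by
    refine hprod.integral_prod_right.congr (Filter.Eventually.of_forall fun t => ?_)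
    simp only [Function.uncurry]
    rw [← integral_const_mul, ← integral_add_right_eq_self _ (ε • t)]
    congr 1
    ext x
    rw [add_sub_cancel_right]
    ring
  have hbd : ∀ {v : E → ℝ}, Integrable v μ → Integrable (fun x => s x * v x) μ := fun hv =>
    hv.bdd_mul (c := 1) hs.aestronglyMeasurable (Filter.Eventually.of_forall fun x => hs1 x)
  have hpt : ∀ t, ρ t * (I - ε * G) ≤ ρ t * ∫ x, s x * w (x + ε • t) ∂μ := by
    intro t
    by_cases ht : ρ t = 0
    · simp [ht]
    refine mul_le_mul_of_nonneg_left ?_ (hρ0 t)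
    have hwt : Integrable (fun x => w (x + ε • t)) μ := hwi.comp_add_right _
    have h1 : I - ∫ x, s x * w (x + ε • t) ∂μ ≤ ∫ x, ‖w (x + ε • t) - w x‖ ∂μ := by
      rw [hI, ← integral_sub (hbd hwi) (hbd hwt)]
      refine integral_mono ((hbd hwi).sub (hbd hwt)) (hwt.sub hwi).norm fun x => ?_
      calc s x * w x - s x * w (x + ε • t) = s x * (w x - w (x + ε • t)) := by ring
        _ ≤ |s x * (w x - w (x + ε • t))| := le_abs_self _
        _ = |s x| * ‖w (x + ε • t) - w x‖ := by rw [abs_mul, abs_sub_comm, Real.norm_eq_abs]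
        _ ≤ ‖w (x + ε • t) - w x‖ := mul_le_of_le_one_left (norm_nonneg _) (hs1 x)
    have h2 := integral_norm_add_sub_le (μ := μ) hw hg (ε • t)
    have h3 : G * ‖ε • t‖ ≤ ε * G := by
      rw [norm_smul, Real.norm_of_nonneg hε.le, mul_comm]
      exact mul_le_mul_of_nonneg_right (mul_le_of_le_one_right hε.le (hρb t ht)) hG0
    linarith
  have hfin := integral_mono (hρi.mul_const _) hJi hpt
  rw [integral_mul_const, hρ1, one_mul, ← hswap] at hfin
  linarith

end Kernel

variable (μ) in
theorem exists_nonneg_contDiff_kernel :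
    ∃ ρ : E → ℝ, ContDiff ℝ 1 ρ ∧ HasCompactSupport ρ ∧ (∀ x, 0 ≤ ρ x) ∧ ∫ x, ρ x ∂μ = 1 ∧
      ∀ x, ρ x ≠ 0 → ‖x‖ ≤ 1 := by
  let f : ContDiffBump (0 : E) := ⟨1 / 2, 1, by norm_num, by norm_num⟩
  refine ⟨f.normed μ, f.contDiff_normed (n := 1), f.hasCompactSupport_normed, f.nonneg_normed,
    f.integral_normed, fun x hx => ?_⟩
  have h : x ∈ Function.support (f.normed μ) := hx
  rw [f.support_normed_eq] at h
  exact (mem_ball_zero_iff.1 h).le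

omit [μ.IsAddHaarMeasure] in
theorem integral_abs_le_of_forall_mul_le {w : E → ℝ} (hw : Measurable w) (hwi : Integrable w μ)
    {B : ℝ} (hB : ∀ s : E → ℝ, Measurable s → HasCompactSupport s → (∀ x, |s x| ≤ 1) →
      ∫ x, s x * w x ∂μ ≤ B) : ∫ x, |w x| ∂μ ≤ B := by
  have hcov : AECover μ Filter.atTop fun n : ℕ => Metric.closedBall (0 : E) n :=
    aecover_closedBall tendsto_natCast_atTop_atTop
  refine le_of_tendsto' (hcov.integral_tendsto_of_countably_generated hwi.abs) fun n => ?_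
  have hsgn : Measurable fun x => if 0 ≤ w x then (1 : ℝ) else -1 :=
    Measurable.ite (measurableSet_le measurable_const hw) measurable_const measurable_const
  have hball : MeasurableSet (Metric.closedBall (0 : E) n) :=
    Metric.isClosed_closedBall.measurableSet
  have h := hB ((Metric.closedBall (0 : E) n).indicator fun x => if 0 ≤ w x then 1 else -1)
    (hsgn.indicator hball)
    (HasCompactSupport.intro (isCompact_closedBall _ _) fun x hx => Set.indicator_of_notMem hx _)
    fun x => by
      by_cases hx : x ∈ Metric.closedBall (0 : E) n
      · rw [Set.indicator_of_mem hx]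
        split_ifs <;> simp
      · simp [Set.indicator_of_notMem hx]
  refine le_of_eq_of_le ?_ h
  rw [← integral_indicator hball]
  congr 1
  ext x
  by_cases hx : x ∈ Metric.closedBall (0 : E) n
  · simp only [Set.indicator_of_mem hx]
    split_ifs with h0
    · rw [abs_of_nonneg h0, one_mul]
    · rw [abs_of_neg (not_le.1 h0), neg_one_mul]
  · simp [Set.indicator_of_notMem hx]

theorem le_mul_sqrt_of_forall_scale {M G A K : ℝ} (hG : 0 ≤ G) (hA : 0 ≤ A) (hAM : A ≤ M)
    (h : ∀ ε : ℝ, 0 < ε → ε ≤ 1 → M ≤ K / ε * A + ε * G) :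
    M ≤ (K + 1) * √(A * (M + G)) := by
  rcases hA.eq_or_lt with rfl | hA
  · have hM : M ≤ 0 := by
      refine le_of_forall_pos_le_add fun δ hδ => ?_
      have hpos : 0 < G + 1 + δ := by linarith
      have h1 := h (δ / (G + 1 + δ)) (by positivity) ((div_le_one hpos).2 (by linarith))
      have h2 : δ / (G + 1 + δ) * G ≤ δ := by
        rw [div_mul_eq_mul_div, div_le_iff₀ hpos]
        nlinarith
      linarith
    simpa using hM
  · have hS : 0 < M + G := by linarith
    have ha := Real.sqrt_pos.2 hA
    have hb := Real.sqrt_pos.2 hS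
    have ha2 := Real.sq_sqrt hA.le
    have hb2 := Real.sq_sqrt hS.le
    have h1 := h (√A / √(M + G)) (by positivity)
      ((div_le_one hb).2 (Real.sqrt_le_sqrt (by linarith)))
    rw [Real.sqrt_mul hA.le]
    have h2 : K / (√A / √(M + G)) * A = K * (√A * √(M + G)) := by
      rw [div_div_eq_mul_div, div_mul_eq_mul_div, div_eq_iff ha.ne']
      linear_combination (-(K * √(M + G))) * ha2
    have h3 : √A / √(M + G) * G ≤ √A * √(M + G) := by
      rw [div_mul_eq_mul_div, div_le_iff₀ hb]
      nlinarith
    linarith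

end Interpolation

theorem norm_gradient_eq_norm_fderiv {F : Type*} [NormedAddCommGroup F] [InnerProductSpace ℝ F]
    [CompleteSpace F] (f : F → ℝ) (x : F) : ‖gradient f x‖ = ‖fderiv ℝ f x‖ :=
  LinearIsometryEquiv.norm_map _ _

theorem stmt_15 (d : ℕ) (hd : 1 ≤ d) :
    ∃ C : ℝ, 0 < C ∧
      ∀ w : Euc d → ℝ, ContDiff ℝ 1 w → Integrable w →
        Integrable (fun x => gradient w x) →
        ∫ x, |w x| ≤ C * Real.sqrt
          (sSup {r : ℝ | ∃ φ : Euc d → ℝ, ContDiff ℝ 1 φ ∧ HasCompactSupport φ ∧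
              (∀ x, |φ x| ≤ 1) ∧ (∀ x, ‖gradient φ x‖ ≤ 1) ∧ r = ∫ x, φ x * w x} *
            ((∫ x, |w x|) + ∫ x, ‖gradient w x‖)) := by
  obtain ⟨ρ, hρ, hρc, hρ0, hρ1, hρb⟩ := exists_nonneg_contDiff_kernel (volume : Measure (Euc d))
  have hρi : Integrable ρ := hρ.continuous.integrable_of_hasCompactSupport hρc
  set K := max 1 (∫ t, ‖fderiv ℝ ρ t‖)
  have hK1 : 1 ≤ K := le_max_left _ _
  have hK0 : 0 < K := one_pos.trans_le hK1
  refine ⟨K + 1, by linarith, fun w hw hwi hgi => ?_⟩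
  have hg : Integrable (fderiv ℝ w) :=
    (integrable_norm_iff (hw.continuous_fderiv one_ne_zero).aestronglyMeasurable).1
      (by simpa only [norm_gradient_eq_norm_fderiv] using hgi.norm)
  simp only [norm_gradient_eq_norm_fderiv]
  set T := {r : ℝ | ∃ φ : Euc d → ℝ, ContDiff ℝ 1 φ ∧ HasCompactSupport φ ∧
    (∀ x, |φ x| ≤ 1) ∧ (∀ x, ‖fderiv ℝ φ x‖ ≤ 1) ∧ r = ∫ x, φ x * w x}
  have hub : ∀ r ∈ T, r ≤ ∫ x, |w x| := by
    rintro r ⟨φ, -, -, hφ, -, rfl⟩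
    refine (Real.le_norm_self _).trans (norm_integral_le_of_norm_le hwi.abs
      (Filter.Eventually.of_forall fun x => ?_))
    rw [norm_mul]
    exact mul_le_of_le_one_left (norm_nonneg _) (hφ x)
  have h0T : (0 : ℝ) ∈ T := ⟨0, contDiff_const, HasCompactSupport.zero, by simp, by simp, by simp⟩
  have hbdd : BddAbove T := ⟨_, hub⟩
  refine le_mul_sqrt_of_forall_scale (integral_nonneg fun _ => norm_nonneg _)
    (le_csSup hbdd h0T) (csSup_le ⟨0, h0T⟩ hub) fun ε hε hε1 => ?_
  refine integral_abs_le_of_forall_mul_le hw.continuous.measurable hwi fun s hs hsc hs1 => ?_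
  refine (integral_mul_le_integral_mollify_mul_add hρ0 hρi hρ1 hρb hs hs1 hε hw hwi hg).trans ?_
  gcongr
  have hφ : ContDiff ℝ 1 (mollify volume ρ s ε) := contDiff_mollify hρ hρc hs hs1
  have hεK : 0 < ε / K := by positivity
  have hmem : ∫ x, (ε / K * mollify volume ρ s ε x) * w x ∈ T := by
    refine ⟨fun x => ε / K * mollify volume ρ s ε x, contDiff_const.mul hφ,
      (hasCompactSupport_mollify hρc hsc hε.ne').mul_left, fun x => ?_, fun x => ?_, rfl⟩
    · rw [abs_mul, abs_of_pos hεK]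
      exact mul_le_one₀ ((div_le_one hK0).2 (hε1.trans hK1)) (abs_nonneg _)
        (abs_mollify_le hρ0 hρi hρ1 hs1 hε.ne' x)
    · rw [fderiv_const_mul ((hφ.differentiable one_ne_zero) x), norm_smul,
        Real.norm_of_nonneg hεK.le]
      calc ε / K * ‖fderiv ℝ (mollify volume ρ s ε) x‖
          ≤ ε / K * (K / ε) := by
            gcongr
            exact (norm_fderiv_mollify_le hρ hρc hs hs1 hε x).trans
              (div_le_div_of_nonneg_right (le_max_right _ _) hε.le)
        _ = 1 := by field_simp
  have hle := le_csSup hbdd hmem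
  simp only [mul_assoc, integral_const_mul] at hle
  rw [div_mul_eq_mul_div, div_le_iff₀ hK0] at hle
  rw [div_mul_eq_mul_div, le_div_iff₀ hε]
  linarith
end
end
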